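/- arXiv:1004.4933 — 3 statements merged into one kernel-verified Lean document; each statement's English description precedes it below -/
import Mathlib

section
/- Let n and m be positive integers, not both equal to 1, and let Θ be an n×m real matrix with α(Θ) < +∞ and β(Θ) < +∞. Then β(ᵗΘ) ≥ ((n−1)(1+β(Θ)^{−1}) − (α(Θ)^{−1}−1)) / ((m−1)(1+β(Θ)^{−1}) + (α(Θ)^{−1}−1)), with the convention a/0 = +∞ for a > 0. -/
open Filter MeasureTheory
open scoped ENNReal RealInnerProductSpace

noncomputable section

/-- `Θ` is uniformly `ψ`-approximable: for every sufficiently large `t > 0` there exist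
integer vectors `x ≠ 0`, `y` with `|x|_∞ ≤ t` and `|Θx - y|_∞ ≤ ψ t`.
(The norm on `Fin k → ℝ` is the sup-norm.) -/
def UniformlyApprox (n m : ℕ) (Θ : Matrix (Fin n) (Fin m) ℝ) (ψ : ℝ → ℝ) : Prop :=
  ∀ᶠ t : ℝ in atTop, ∃ (x : Fin m → ℤ) (y : Fin n → ℤ), x ≠ 0 ∧
    ‖(fun j => (x j : ℝ))‖ ≤ t ∧
    ‖Θ.mulVec (fun j => (x j : ℝ)) - (fun i => (y i : ℝ))‖ ≤ ψ t

/-- `Θ` is (individually) `ψ`-approximable: there are infinitely many pairs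
`(x, y) ∈ ℤ^m × ℤ^n` with `|Θx - y|_∞ ≤ ψ (|x|_∞)`. -/
def IndivApprox (n m : ℕ) (Θ : Matrix (Fin n) (Fin m) ℝ) (ψ : ℝ → ℝ) : Prop :=
  {p : (Fin m → ℤ) × (Fin n → ℤ) |
    ‖Θ.mulVec (fun j => (p.1 j : ℝ)) - (fun i => (p.2 i : ℝ))‖ ≤
      ψ (‖(fun j => (p.1 j : ℝ))‖)}.Infinite

/-- The uniform Diophantine exponent `α(Θ) ∈ [0, +∞]`. -/
def alphaExp (n m : ℕ) (Θ : Matrix (Fin n) (Fin m) ℝ) : ℝ≥0∞ :=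
  sSup (ENNReal.ofReal '' {γ : ℝ | 0 < γ ∧ UniformlyApprox n m Θ (fun t => t ^ (-γ))})

/-- The individual Diophantine exponent `β(Θ) ∈ [0, +∞]`. -/
def betaExp (n m : ℕ) (Θ : Matrix (Fin n) (Fin m) ℝ) : ℝ≥0∞ :=
  sSup (ENNReal.ofReal '' {γ : ℝ | 0 < γ ∧ IndivApprox n m Θ (fun t => t ^ (-γ))})

/-- `Δ_d = 2^{1-d} d^{-1/2} vol_{d-1} {x ∈ [-1,1]^d : x_1 + ⋯ + x_d = 0}`. -/
def Delta (d : ℕ) : ℝ :=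
  (2:ℝ) ^ (1 - (d:ℤ)) * (Real.sqrt d)⁻¹ *
    (μH[(d:ℝ) - 1] {x : EuclideanSpace ℝ (Fin d) | (∀ i, |x i| ≤ 1) ∧ ∑ i, x i = 0}).toReal

/-- The parallelepiped `M_{h,r} = {(x,y) : |Θx - y|_∞ ≤ h, |x|_∞ ≤ r}`. -/
def Mset (n m : ℕ) (Θ : Matrix (Fin n) (Fin m) ℝ) (h r : ℝ) :
    Set ((Fin m → ℝ) × (Fin n → ℝ)) :=
  {p | ‖Θ.mulVec p.1 - p.2‖ ≤ h ∧ ‖p.1‖ ≤ r}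

/-- The parallelepiped `M̂_{h,r} = {(x,y) : |y|_∞ ≤ h, |ᵗΘ y - x|_∞ ≤ r}`. -/
def MhatSet (n m : ℕ) (Θ : Matrix (Fin n) (Fin m) ℝ) (h r : ℝ) :
    Set ((Fin m → ℝ) × (Fin n → ℝ)) :=
  {p | ‖p.2‖ ≤ h ∧ ‖Θ.transpose.mulVec p.2 - p.1‖ ≤ r}

/-- The section-dual `M^∧` of a set `M ⊆ ℝ^d`. -/
def sectionDual (d : ℕ) (M : Set (EuclideanSpace ℝ (Fin d))) :
    Set (EuclideanSpace ℝ (Fin d)) :=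
  {v | ∃ (e : EuclideanSpace ℝ (Fin d)) (l : ℝ), ‖e‖ = 1 ∧ 0 ≤ l ∧
    l ≤ (2:ℝ) ^ (1 - (d:ℤ)) * (μH[(d:ℝ) - 1] (M ∩ {x | ⟪e, x⟫ = 0})).toReal ∧ v = l • e}

/-- **Minkowski's linear forms theorem**, with strict inequalities. -/
theorem exists_int_abs_mulVec_lt {ι : Type*} [Fintype ι] [DecidableEq ι] (A : Matrix ι ι ℝ)
    (hA : A.det ≠ 0) (c : ι → ℝ) (hc : ∀ i, 0 < c i) (h : |A.det| < ∏ i, c i) :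
    ∃ z : ι → ℤ, z ≠ 0 ∧ ∀ i, |A.mulVec (fun j => (z j : ℝ)) i| < c i := by
  classical
  set s : Set (ι → ℝ) := Matrix.toLin' A ⁻¹' Set.pi Set.univ (fun i => Set.Ioo (-c i) (c i)) with hs
  have hdet : LinearMap.det (Matrix.toLin' A) ≠ 0 := by rwa [LinearMap.det_toLin']
  have hvol : volume s = ENNReal.ofReal (2 ^ Fintype.card ι * ((∏ i, c i) / |A.det|)) := by
    rw [hs, Measure.addHaar_preimage_linearMap _ hdet, Real.volume_pi_Ioo, LinearMap.det_toLin',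
      ← ENNReal.ofReal_prod_of_nonneg (fun i _ => by linarith [hc i]),
      ← ENNReal.ofReal_mul (abs_nonneg _)]
    congr 1
    have : ∏ i, (c i - -c i) = 2 ^ Fintype.card ι * ∏ i, c i := by
      simp only [sub_neg_eq_add, ← two_mul, Finset.prod_mul_distrib, Finset.prod_const,
        Finset.card_univ]
    rw [this, abs_inv]
    ring
  have hfund := ZSpan.isAddFundamentalDomain' (Pi.basisFun ℝ ι) (volume : Measure (ι → ℝ))
  have hcov : volume (ZSpan.fundamentalDomain (Pi.basisFun ℝ ι)) = 1 := by
    rw [ZSpan.fundamentalDomain_pi_basisFun]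
    simp [Real.volume_pi_Ico]
  have : Countable (Submodule.span ℤ (Set.range (Pi.basisFun ℝ ι))).toAddSubgroup :=
    inferInstanceAs (Countable (Submodule.span ℤ (Set.range (Pi.basisFun ℝ ι))))
  have hsymm : ∀ x ∈ s, -x ∈ s := fun x hx => by
    rw [hs, Set.mem_preimage, Set.mem_univ_pi] at hx ⊢
    intro i
    have := hx i
    rw [map_neg]
    simp only [Set.mem_Ioo, Pi.neg_apply] at this ⊢
    constructor <;> linarith [this.1, this.2]
  have hconv : Convex ℝ s := (convex_pi fun i _ => convex_Ioo _ _).linear_preimage _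
  have hlt : volume (ZSpan.fundamentalDomain (Pi.basisFun ℝ ι)) *
      2 ^ Module.finrank ℝ (ι → ℝ) < volume s := by
    rw [hcov, hvol, one_mul, Module.finrank_fintype_fun_eq_card,
      ENNReal.ofReal_mul (by positivity), ENNReal.ofReal_pow (by norm_num)]
    have h1 : 1 < (∏ i, c i) / |A.det| := (one_lt_div (abs_pos.2 hA)).2 h
    have h2 : ENNReal.ofReal 2 = 2 := by simp
    rw [h2]
    calc (2 : ℝ≥0∞) ^ Fintype.card ι = 2 ^ Fintype.card ι * 1 := (mul_one _).symm
      _ < _ := by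
        refine (ENNReal.mul_lt_mul_iff_right (by simp) (by finiteness)).2 ?_
        rwa [← ENNReal.ofReal_one, ENNReal.ofReal_lt_ofReal_iff (by linarith)]
  obtain ⟨⟨x, hxL⟩, hx0, hxs⟩ := exists_ne_zero_mem_lattice_of_measure_mul_two_pow_lt_measure
    hfund hsymm hconv hlt
  rw [Submodule.mem_toAddSubgroup, (Pi.basisFun ℝ ι).mem_span_iff_repr_mem ℤ x] at hxL
  choose z hz using hxL
  have hxz : x = fun j => (z j : ℝ) := by
    funext j
    simpa using (hz j).symm
  refine ⟨z, ?_, fun i => ?_⟩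
  · rintro rfl
    apply hx0
    simp [hxz]
    rfl
  · rw [hs, Set.mem_preimage, Set.mem_univ_pi] at hxs
    have := hxs i
    simp only [Matrix.toLin'_apply] at this
    rw [← hxz]
    exact abs_lt.2 this

/-- The determinant of the identity matrix with rows `a ≠ b` replaced by `v` and `w`. -/
theorem det_one_add_replace_two_rows {ι : Type*} [Fintype ι] [DecidableEq ι] {a b : ι}
    (hab : a ≠ b) (v w : ι → ℝ) :
    (1 + Matrix.vecMulVec (Pi.single a 1) (v - Pi.single a 1)
      + Matrix.vecMulVec (Pi.single b 1) (w - Pi.single b 1)).det = v a * w b - v b * w a := by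
  have key : Matrix.vecMulVec (Pi.single a 1) (v - Pi.single a 1)
      + Matrix.vecMulVec (Pi.single b 1) (w - Pi.single b 1) =
      (Matrix.of fun i (k : Fin 2) => (![Pi.single a 1, Pi.single b 1] : Fin 2 → ι → ℝ) k i) *
      (Matrix.of ![v - Pi.single a 1, w - Pi.single b 1]) := by
    ext i j
    simp [Matrix.mul_apply, Matrix.vecMulVec_apply, Fin.sum_univ_two]
  rw [add_assoc, key, Matrix.det_one_add_mul_comm, Matrix.det_fin_two]
  simp only [Matrix.add_apply, Matrix.one_apply, Matrix.mul_apply, Matrix.of_apply]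
  simp [Pi.single_apply, hab, hab.symm]

/-- Transference through a pair of vectors: if `v` and `w` are linearly independent and take
integer values on the unimodular lattice `B ℤ^ι`, then a box whose volume dominates all the scaled
Plücker coordinates of `v ∧ w` contains, up to a factor, a nonzero lattice point. -/
theorem exists_lattice_point_of_plucker_lt {ι : Type*} [Fintype ι] [DecidableEq ι]
    (B : Matrix ι ι ℝ) (hB : |B.det| = 1) (v w : ι → ℝ)
    (hv : ∀ z : ι → ℤ, ∃ k : ℤ, v ⬝ᵥ B.mulVec (fun j => (z j : ℝ)) = k)
    (hw : ∀ z : ι → ℤ, ∃ k : ℤ, w ⬝ᵥ B.mulVec (fun j => (z j : ℝ)) = k)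
    (hne : ∃ i j, v i * w j - v j * w i ≠ 0) (s : ι → ℝ) (hs : ∀ i, 0 < s i)
    (hlt : ∀ i j, i ≠ j → |v i * w j - v j * w i| * (s i * s j) < ∏ k, s k) :
    ∃ z : ι → ℤ, z ≠ 0 ∧
      ∀ i, |B.mulVec (fun j => (z j : ℝ)) i| ≤ Fintype.card ι * s i := by
  obtain ⟨i₀, j₀, hij⟩ := hne
  obtain ⟨⟨a, b⟩, -, hmax⟩ := Finset.exists_max_image (Finset.univ : Finset (ι × ι))
    (fun q => |v q.1 * w q.2 - v q.2 * w q.1| * (s q.1 * s q.2)) ⟨(i₀, j₀), Finset.mem_univ _⟩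
  simp only [Finset.mem_univ, true_imp_iff, Prod.forall] at hmax
  have hpos : 0 < |v a * w b - v b * w a| * (s a * s b) :=
    (mul_pos (abs_pos.2 hij) (mul_pos (hs _) (hs _))).trans_le (hmax i₀ j₀)
  have hp : 0 < |v a * w b - v b * w a| :=
    pos_of_mul_pos_left hpos (mul_pos (hs a) (hs b)).le
  have hab : a ≠ b := by
    rintro rfl
    simp at hp
  set A : Matrix ι ι ℝ := 1 + Matrix.vecMulVec (Pi.single a 1) (v - Pi.single a 1)
      + Matrix.vecMulVec (Pi.single b 1) (w - Pi.single b 1) with hA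
  have hAdet : A.det = v a * w b - v b * w a := det_one_add_replace_two_rows hab v w
  have hABdet : |(A * B).det| = |v a * w b - v b * w a| := by
    rw [Matrix.det_mul, abs_mul, hB, mul_one, hAdet]
  set c : ι → ℝ := Function.update (Function.update s a 1) b 1 with hcdef
  have hca : c a = 1 := by simp [hcdef, hab]
  have hcb : c b = 1 := by simp [hcdef]
  have hcs : ∀ i, i ≠ a → i ≠ b → c i = s i := fun i h1 h2 => by simp [hcdef, h1, h2]
  have hc : ∀ i, 0 < c i := fun i => by
    by_cases h1 : i = a
    · rw [h1, hca]; exact one_pos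
    by_cases h2 : i = b
    · rw [h2, hcb]; exact one_pos
    rw [hcs i h1 h2]; exact hs i
  have hprod : (∏ k, c k) * (s a * s b) = ∏ k, s k := by
    have hb : b ∈ (Finset.univ : Finset ι).erase a := by simp [hab.symm]
    rw [← Finset.mul_prod_erase _ c (Finset.mem_univ a), ← Finset.mul_prod_erase _ c hb,
      ← Finset.mul_prod_erase _ s (Finset.mem_univ a), ← Finset.mul_prod_erase _ s hb, hca, hcb]
    have : ∏ k ∈ (Finset.univ.erase a).erase b, c k = ∏ k ∈ (Finset.univ.erase a).erase b, s k :=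
      Finset.prod_congr rfl fun k hk => by
        simp only [Finset.mem_erase, Finset.mem_univ, and_true] at hk
        exact hcs k hk.2 hk.1
    rw [this]
    ring
  obtain ⟨z, hz0, hz⟩ := exists_int_abs_mulVec_lt (A * B)
    (by rw [← abs_pos, hABdet]; exact hp) c hc (by
      rw [hABdet]
      have := hlt a b hab
      rw [← hprod] at this
      exact lt_of_mul_lt_mul_right this (mul_pos (hs a) (hs b)).le)
  refine ⟨z, hz0, ?_⟩
  obtain ⟨kv, hkv⟩ := hv z
  obtain ⟨kw, hkw⟩ := hw z
  simp only [← Matrix.mulVec_mulVec] at hz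
  set u := B.mulVec (fun j => (z j : ℝ)) with hu
  have hrow : ∀ i, A.mulVec u i = u i + Pi.single (M := fun _ => ℝ) a 1 i * (v ⬝ᵥ u - u a)
      + Pi.single (M := fun _ => ℝ) b 1 i * (w ⬝ᵥ u - u b) := fun i => by
    rw [hA]
    simp [Matrix.add_mulVec, Matrix.vecMulVec_mulVec, sub_dotProduct]
  have hui : ∀ i, i ≠ a → i ≠ b → |u i| ≤ s i := fun i h1 h2 => by
    have := hz i
    rw [hrow, hcs i h1 h2] at this
    simp only [Pi.single_apply, h1, h2, if_false, zero_mul, add_zero] at this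
    exact this.le
  have hv0 : v ⬝ᵥ u = 0 := by
    have := hz a
    rw [hrow, hca] at this
    simp only [Pi.single_apply, hab, if_false, if_true, zero_mul, add_zero, one_mul] at this
    rw [add_sub_cancel, hkv] at this
    have hk : kv = 0 := Int.abs_lt_one_iff.1 (by exact_mod_cast this)
    rw [hkv, hk, Int.cast_zero]
  have hw0 : w ⬝ᵥ u = 0 := by
    have := hz b
    rw [hrow, hcb] at this
    simp only [Pi.single_apply, hab.symm, if_false, if_true, zero_mul, add_zero, one_mul] at this
    rw [add_sub_cancel, hkw] at this
    have hk : kw = 0 := Int.abs_lt_one_iff.1 (by exact_mod_cast this)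
    rw [hkw, hk, Int.cast_zero]
  have hcard : (1 : ℝ) ≤ Fintype.card ι := by
    exact_mod_cast Fintype.card_pos_iff.2 ⟨a⟩
  have key : ∀ a' b' : ι, (∀ i, i ≠ a' → i ≠ b' → |u i| ≤ s i) →
      0 < |v a' * w b' - v b' * w a'| →
      (∀ i, |v i * w b' - v b' * w i| * (s i * s b') ≤
        |v a' * w b' - v b' * w a'| * (s a' * s b')) →
      |u a'| ≤ Fintype.card ι * s a' := by
    intro a' b' hui hp hmax
    have hsum : ∑ i, u i * (v i * w b' - v b' * w i) = 0 := by
      have : ∑ i, u i * (v i * w b' - v b' * w i) = w b' * (v ⬝ᵥ u) - v b' * (w ⬝ᵥ u) := by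
        simp only [dotProduct, Finset.mul_sum, ← Finset.sum_sub_distrib]
        exact Finset.sum_congr rfl fun i _ => by ring
      rw [this, hv0, hw0]
      ring
    rw [← Finset.add_sum_erase _ _ (Finset.mem_univ a')] at hsum
    have hterm : ∀ i ∈ Finset.univ.erase a', |u i * (v i * w b' - v b' * w i)| ≤
        |v a' * w b' - v b' * w a'| * s a' := fun i hi => by
      rw [abs_mul]
      by_cases hib : i = b'
      · have : v i * w b' - v b' * w i = 0 := by rw [hib]; ring
        rw [this, abs_zero, mul_zero]
        exact mul_nonneg (abs_nonneg _) (hs _).le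
      · have h1 : |v i * w b' - v b' * w i| * s i ≤ |v a' * w b' - v b' * w a'| * s a' := by
          refine le_of_mul_le_mul_right ?_ (hs b')
          linarith [hmax i]
        calc _ ≤ s i * |v i * w b' - v b' * w i| :=
              mul_le_mul_of_nonneg_right (hui i (Finset.ne_of_mem_erase hi) hib) (abs_nonneg _)
          _ ≤ _ := by rw [mul_comm]; exact h1
    have h2 : |u a' * (v a' * w b' - v b' * w a')| ≤
        Fintype.card ι * (|v a' * w b' - v b' * w a'| * s a') := by
      rw [eq_neg_of_add_eq_zero_left hsum, abs_neg]
      refine (Finset.abs_sum_le_sum_abs _ _).trans ((Finset.sum_le_sum hterm).trans ?_)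
      rw [Finset.sum_const, nsmul_eq_mul]
      refine mul_le_mul_of_nonneg_right ?_ (mul_nonneg (abs_nonneg _) (hs _).le)
      exact_mod_cast Finset.card_le_univ _
    rw [abs_mul] at h2
    refine le_of_mul_le_mul_right ?_ hp
    linarith
  intro i
  by_cases h1 : i = a
  · rw [h1]
    exact key a b hui hp fun i => hmax i b
  by_cases h2 : i = b
  · rw [h2]
    have hswap : ∀ i j, |v i * w j - v j * w i| = |v j * w i - v i * w j| := fun i j =>
      abs_sub_comm _ _
    refine key b a (fun i h1 h2 => hui i h2 h1) (by rwa [hswap]) fun i => ?_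
    have := hmax i a
    rw [hswap b a, mul_comm (s b)]
    exact this
  exact (hui i h1 h2).trans (le_mul_of_one_le_left (hs i).le hcard)

theorem one_le_norm_intCast {k : ℕ} {x : Fin k → ℤ} (hx : x ≠ 0) :
    1 ≤ ‖(fun j => (x j : ℝ))‖ := by
  obtain ⟨j, hj⟩ := Function.ne_iff.1 hx
  refine le_trans ?_ (norm_le_pi_norm (fun j => (x j : ℝ)) j)
  rw [Real.norm_eq_abs]
  exact_mod_cast Int.one_le_abs hj

theorem finite_intCast_norm_sub_le {k : ℕ} (c : Fin k → ℝ) (M : ℝ) :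
    {z : Fin k → ℤ | ‖c - (fun j => (z j : ℝ))‖ ≤ M}.Finite := by
  refine (Set.Finite.pi' fun j => Set.finite_Icc ⌈c j - M⌉ ⌊c j + M⌋).subset fun z hz j => ?_
  have := (norm_le_pi_norm _ j).trans (Set.mem_ofPred_eq ▸ hz)
  rw [Pi.sub_apply, Real.norm_eq_abs, abs_le] at this
  exact ⟨Int.ceil_le.2 (by linarith), Int.le_floor.2 (by linarith)⟩

theorem finite_pairs_norm_le {n m : ℕ} (Θ : Matrix (Fin n) (Fin m) ℝ) (N M : ℝ) :
    {p : (Fin m → ℤ) × (Fin n → ℤ) | ‖(fun j => (p.1 j : ℝ))‖ ≤ N ∧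
      ‖Θ.mulVec (fun j => (p.1 j : ℝ)) - (fun i => (p.2 i : ℝ))‖ ≤ M}.Finite := by
  have h1 : {x : Fin m → ℤ | ‖(fun j => (x j : ℝ))‖ ≤ N}.Finite := by
    simpa using finite_intCast_norm_sub_le (0 : Fin m → ℝ) N
  refine (h1.biUnion fun x _ => (finite_intCast_norm_sub_le
    (Θ.mulVec (fun j => (x j : ℝ))) M).image (Prod.mk x)).subset ?_
  rintro ⟨x, y⟩ ⟨hx, hy⟩
  exact Set.mem_biUnion (show x ∈ _ from hx) ⟨y, hy, rfl⟩

/-- Below any pair with `x₀ ≠ 0` there is one whose residual is minimal among all nonzero `x'`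
of at most its own height. -/
theorem exists_minimal_pair {n m : ℕ} (Θ : Matrix (Fin n) (Fin m) ℝ) (x₀ : Fin m → ℤ)
    (y₀ : Fin n → ℤ) (hx₀ : x₀ ≠ 0) :
    ∃ (x : Fin m → ℤ) (y : Fin n → ℤ), x ≠ 0 ∧
      ‖(fun j => (x j : ℝ))‖ ≤ ‖(fun j => (x₀ j : ℝ))‖ ∧
      ‖Θ.mulVec (fun j => (x j : ℝ)) - (fun i => (y i : ℝ))‖ ≤
        ‖Θ.mulVec (fun j => (x₀ j : ℝ)) - (fun i => (y₀ i : ℝ))‖ ∧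
      ∀ (x' : Fin m → ℤ) (y' : Fin n → ℤ), x' ≠ 0 →
        ‖(fun j => (x' j : ℝ))‖ ≤ ‖(fun j => (x j : ℝ))‖ →
        ‖Θ.mulVec (fun j => (x j : ℝ)) - (fun i => (y i : ℝ))‖ ≤
          ‖Θ.mulVec (fun j => (x' j : ℝ)) - (fun i => (y' i : ℝ))‖ := by
  set L : (Fin m → ℤ) × (Fin n → ℤ) → ℝ :=
    fun p => ‖Θ.mulVec (fun j => (p.1 j : ℝ)) - (fun i => (p.2 i : ℝ))‖ with hL
  have hfin := (finite_pairs_norm_le Θ ‖(fun j => (x₀ j : ℝ))‖ (L (x₀, y₀))).inter_of_left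
    {p | p.1 ≠ 0}
  obtain ⟨⟨x, y⟩, ⟨⟨hx, hy⟩, hx0⟩, hmin⟩ := Set.exists_min_image _ L hfin
    ⟨(x₀, y₀), ⟨⟨le_rfl, le_rfl⟩, hx₀⟩⟩
  refine ⟨x, y, hx0, hx, hy, fun x' y' hx' hle => ?_⟩
  by_cases h : L (x', y') ≤ L (x₀, y₀)
  · exact hmin (x', y') ⟨⟨hle.trans hx, h⟩, hx'⟩
  · exact hy.trans (not_le.1 h).le

/-- Individual approximability follows from approximations with arbitrarily small residual. -/
theorem indivApprox_of_forall_small {n m : ℕ} {Θ : Matrix (Fin n) (Fin m) ℝ} {γ : ℝ}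
    (h : ∀ ε > 0, ∃ (x : Fin m → ℤ) (y : Fin n → ℤ), x ≠ 0 ∧
      ‖Θ.mulVec (fun j => (x j : ℝ)) - (fun i => (y i : ℝ))‖ ≤ ‖(fun j => (x j : ℝ))‖ ^ (-γ) ∧
      ‖Θ.mulVec (fun j => (x j : ℝ)) - (fun i => (y i : ℝ))‖ < ε) :
    IndivApprox n m Θ (fun t => t ^ (-γ)) := by
  set L : (Fin m → ℤ) × (Fin n → ℤ) → ℝ :=
    fun p => ‖Θ.mulVec (fun j => (p.1 j : ℝ)) - (fun i => (p.2 i : ℝ))‖ with hL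
  by_cases hz : ∃ (x : Fin m → ℤ) (y : Fin n → ℤ), x ≠ 0 ∧ L (x, y) = 0
  · obtain ⟨x, y, hx, hxy⟩ := hz
    refine Set.infinite_of_injective_forall_mem
      (f := fun k : ℕ => ((k : ℤ) • x, (k : ℤ) • y)) ?_ ?_
    · intro k l hkl
      have := congrArg Prod.fst hkl
      exact_mod_cast smul_left_injective ℤ hx this
    · intro k
      have hxy' := norm_eq_zero.1 hxy
      have h1 : (fun j => (((k : ℤ) • x) j : ℝ)) = (k : ℝ) • (fun j => (x j : ℝ)) := by
        ext j; simp
      have h2 : (fun j => (((k : ℤ) • y) j : ℝ)) = (k : ℝ) • (fun j => (y j : ℝ)) := by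
        ext j; simp
      simp only [Set.mem_ofPred_eq]
      rw [h1, h2, Matrix.mulVec_smul, ← smul_sub]
      simp only at hxy'
      rw [hxy', smul_zero, norm_zero]
      positivity
  · push Not at hz
    intro hfin
    have hfin' := hfin.inter_of_left {p | p.1 ≠ 0}
    obtain ⟨x₁, y₁, hx₁, hle₁, -⟩ := h 1 one_pos
    obtain ⟨⟨x, y⟩, ⟨-, hx⟩, hmin⟩ := Set.exists_min_image _ L hfin' ⟨(x₁, y₁), hle₁, hx₁⟩
    obtain ⟨x₂, y₂, hx₂, hle₂, hlt⟩ := h (L (x, y))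
      (lt_of_le_of_ne (norm_nonneg _) (hz x y hx).symm)
    exact absurd hlt (not_lt.2 (hmin (x₂, y₂) ⟨hle₂, hx₂⟩))

theorem IndivApprox.exists_small {n m : ℕ} {Θ : Matrix (Fin n) (Fin m) ℝ} {γ : ℝ} (hγ : 0 < γ)
    (h : IndivApprox n m Θ (fun t => t ^ (-γ))) {ε : ℝ} (hε : 0 < ε) :
    ∃ (x : Fin m → ℤ) (y : Fin n → ℤ), x ≠ 0 ∧
      ‖Θ.mulVec (fun j => (x j : ℝ)) - (fun i => (y i : ℝ))‖ ≤ ‖(fun j => (x j : ℝ))‖ ^ (-γ) ∧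
      ‖Θ.mulVec (fun j => (x j : ℝ)) - (fun i => (y i : ℝ))‖ < ε := by
  by_contra! hcon
  refine h ((finite_pairs_norm_le Θ (ε ^ (-γ)⁻¹) 1).subset ?_)
  rintro ⟨x, y⟩ hxy
  simp only [Set.mem_ofPred_eq] at hxy ⊢
  by_cases hx : x = 0
  · subst hx
    have h0 : ‖(fun j : Fin m => ((0 : Fin m → ℤ) j : ℝ))‖ = 0 := by
      simp [← Pi.zero_def]
    rw [h0] at hxy ⊢
    rw [Real.zero_rpow (by linarith)] at hxy
    exact ⟨by positivity, hxy.trans zero_le_one⟩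
  · have h1 := one_le_norm_intCast hx
    refine ⟨?_, hxy.trans (Real.rpow_le_one_of_one_le_of_nonpos h1 (by linarith))⟩
    rw [Real.le_rpow_inv_iff_of_neg (by linarith) hε (by linarith)]
    exact (hcon x y hx hxy).trans hxy

theorem rpow_neg_norm_intCast_anti {k : ℕ} (x : Fin k → ℤ) {γ γ' : ℝ} (hγ : 0 < γ)
    (h : γ ≤ γ') :
    ‖(fun j => (x j : ℝ))‖ ^ (-γ') ≤ ‖(fun j => (x j : ℝ))‖ ^ (-γ) := by
  by_cases hx : x = 0
  · subst hx
    have h0 : ‖(fun j : Fin k => ((0 : Fin k → ℤ) j : ℝ))‖ = 0 := by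
      simp [← Pi.zero_def]
    rw [h0, Real.zero_rpow (by linarith), Real.zero_rpow (by linarith)]
  · exact Real.rpow_le_rpow_of_exponent_le (one_le_norm_intCast hx) (by linarith)

theorem uniformlyApprox_of_lt_alphaExp {n m : ℕ} {Θ : Matrix (Fin n) (Fin m) ℝ} {γ : ℝ}
    (h : ENNReal.ofReal γ < alphaExp n m Θ) :
    UniformlyApprox n m Θ (fun t => t ^ (-γ)) := by
  obtain ⟨_, ⟨γ', ⟨h0, hγ'⟩, rfl⟩, hlt⟩ := lt_sSup_iff.1 h
  have hle := ((ENNReal.ofReal_lt_ofReal_iff h0).1 hlt).le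
  filter_upwards [hγ', eventually_ge_atTop 1] with t ht ht1
  obtain ⟨x, y, hx, hxt, hxy⟩ := ht
  exact ⟨x, y, hx, hxt, hxy.trans (Real.rpow_le_rpow_of_exponent_le ht1 (by linarith))⟩

theorem indivApprox_of_lt_betaExp {n m : ℕ} {Θ : Matrix (Fin n) (Fin m) ℝ} {γ : ℝ} (hγ : 0 < γ)
    (h : ENNReal.ofReal γ < betaExp n m Θ) :
    IndivApprox n m Θ (fun t => t ^ (-γ)) := by
  obtain ⟨_, ⟨γ', ⟨h0, hγ'⟩, rfl⟩, hlt⟩ := lt_sSup_iff.1 h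
  have hle := ((ENNReal.ofReal_lt_ofReal_iff h0).1 hlt).le
  exact hγ'.mono fun p hp => le_trans hp (rpow_neg_norm_intCast_anti _ hγ hle)

theorem le_betaExp {n m : ℕ} {Θ : Matrix (Fin n) (Fin m) ℝ} {γ : ℝ} (hγ : 0 < γ)
    (h : IndivApprox n m Θ (fun t => t ^ (-γ))) : ENNReal.ofReal γ ≤ betaExp n m Θ :=
  le_sSup ⟨γ, ⟨hγ, h⟩, rfl⟩

theorem alphaExp_le_betaExp {n m : ℕ} (Θ : Matrix (Fin n) (Fin m) ℝ) :
    alphaExp n m Θ ≤ betaExp n m Θ := by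
  refine sSup_le ?_
  rintro _ ⟨γ, ⟨hγ, hu⟩, rfl⟩
  refine le_betaExp hγ (indivApprox_of_forall_small fun ε hε => ?_)
  have hsmall : ∀ᶠ t : ℝ in atTop, t ^ (-γ) < ε :=
    (tendsto_rpow_neg_atTop hγ).eventually_lt_const hε
  obtain ⟨t, ⟨x, y, hx, hxt, hxy⟩, ht⟩ := (hu.and hsmall).exists
  have h1 := one_le_norm_intCast hx
  exact ⟨x, y, hx, hxy.trans (Real.rpow_le_rpow_of_nonpos (by linarith) hxt (by linarith)),
    hxy.trans_lt ht⟩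

theorem residual_ne_zero_of_betaExp_ne_top {n m : ℕ} {Θ : Matrix (Fin n) (Fin m) ℝ}
    (h : betaExp n m Θ ≠ ⊤) {x : Fin m → ℤ} (hx : x ≠ 0) (y : Fin n → ℤ) :
    0 < ‖Θ.mulVec (fun j => (x j : ℝ)) - (fun i => (y i : ℝ))‖ := by
  refine lt_of_le_of_ne (norm_nonneg _) fun h0 => h ?_
  refine ENNReal.eq_top_of_forall_nnreal_le fun r => ?_
  have : (r : ℝ≥0∞) ≤ ENNReal.ofReal (r + 1) := by
    rw [← ENNReal.ofReal_coe_nnreal]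
    exact ENNReal.ofReal_le_ofReal (by linarith)
  refine this.trans (le_betaExp (by positivity) (indivApprox_of_forall_small fun ε hε =>
    ⟨x, y, hx, ?_, by rwa [← h0]⟩))
  rw [← h0]
  positivity

/-- The uniform exponent is positive, by Minkowski's linear forms theorem. -/
theorem alphaExp_pos {n m : ℕ} (hn : 0 < n) (hm : 0 < m) (Θ : Matrix (Fin n) (Fin m) ℝ) :
    0 < alphaExp n m Θ := by
  have hn' : (0 : ℝ) < n := by exact_mod_cast hn
  have hm' : (0 : ℝ) < m := by exact_mod_cast hm
  set γ : ℝ := m / (2 * n) with hγ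
  have hγ0 : 0 < γ := by positivity
  refine lt_of_lt_of_le (ENNReal.ofReal_pos.2 hγ0) (le_sSup ⟨γ, ⟨hγ0, ?_⟩, rfl⟩)
  filter_upwards [eventually_gt_atTop 1] with t ht
  have ht0 : 0 < t := by linarith
  set A : Matrix (Fin m ⊕ Fin n) (Fin m ⊕ Fin n) ℝ := Matrix.fromBlocks 1 0 Θ (-1) with hA
  have hdet : |A.det| = 1 := by
    rw [hA, Matrix.det_fromBlocks_zero₁₂, Matrix.det_one, one_mul, Matrix.det_neg, Matrix.det_one]
    simp
  obtain ⟨z, hz0, hz⟩ := exists_int_abs_mulVec_lt A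
    (by rw [← abs_pos, hdet]; exact one_pos)
    (Sum.elim (fun _ => t) (fun _ => t ^ (-γ))) (by
      rintro (i | i)
      · exact ht0
      · exact Real.rpow_pos_of_pos ht0 _) (by
      rw [hdet, Fintype.prod_sum_type]
      simp only [Sum.elim_inl, Sum.elim_inr, Finset.prod_const, Finset.card_univ, Fintype.card_fin]
      rw [← Real.rpow_natCast, ← Real.rpow_mul_natCast ht0.le, ← Real.rpow_add ht0]
      refine Real.one_lt_rpow ht ?_
      rw [hγ]
      field_simp
      linarith)
  have hAz : A.mulVec (fun j => (z j : ℝ)) = Sum.elim (fun j => (z (Sum.inl j) : ℝ))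
      (Θ.mulVec (fun j => (z (Sum.inl j) : ℝ)) - (fun i => (z (Sum.inr i) : ℝ))) := by
    rw [hA, Matrix.fromBlocks_mulVec]
    simp [Function.comp_def, sub_eq_add_neg, Matrix.neg_mulVec]
  rw [hAz] at hz
  refine ⟨fun j => z (Sum.inl j), fun i => z (Sum.inr i), ?_, ?_, ?_⟩
  · intro h0
    have h0' : ∀ j, z (Sum.inl j) = 0 := fun j => congrFun h0 j
    apply hz0
    funext i
    rcases i with j | i
    · exact h0' j
    · have h1 := hz (Sum.inr i)
      simp only [Sum.elim_inr, Pi.sub_apply, h0', Int.cast_zero] at h1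
      rw [← Pi.zero_def, Matrix.mulVec_zero, Pi.zero_apply, zero_sub, abs_neg] at h1
      have h2 := h1.trans (Real.rpow_lt_one_of_one_lt_of_neg ht (by linarith))
      exact Int.abs_lt_one_iff.1 (by exact_mod_cast h2)
  · exact (pi_norm_le_iff_of_nonneg ht0.le).2 fun j => (hz (Sum.inl j)).le
  · exact (pi_norm_le_iff_of_nonneg (by positivity)).2 fun i => (hz (Sum.inr i)).le

/-- Two independent approximations for `Θ` of heights `X ≤ X'` and quality `U` yield a nonzero
integer point for the transposed problem, up to the factor `m + n`, in any box `(H, R)` with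
`X * R = U * H` that is large enough compared with their Plücker coordinates. -/
theorem exists_dual_pair {n m : ℕ} (Θ : Matrix (Fin n) (Fin m) ℝ) {x x' : Fin m → ℤ}
    {y y' : Fin n → ℤ} {X X' U H R : ℝ} (hx : x ≠ 0)
    (hxX : ‖(fun j => (x j : ℝ))‖ ≤ X) (hxX' : ‖(fun j => (x' j : ℝ))‖ ≤ X')
    (hU : ‖Θ.mulVec (fun j => (x j : ℝ)) - (fun i => (y i : ℝ))‖ ≤ U)
    (hU' : ‖Θ.mulVec (fun j => (x' j : ℝ)) - (fun i => (y' i : ℝ))‖ ≤ U)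
    (hXX' : X ≤ X') (hH : 0 < H) (hR : 0 < R) (hXR : X * R = U * H)
    (hvol : 2 * X' * U * H * R < R ^ m * H ^ n)
    (hind : ∀ r : ℝ, (fun j => (x' j : ℝ)) = r • (fun j => (x j : ℝ)) →
      Θ.mulVec (fun j => (x' j : ℝ)) - (fun i => (y' i : ℝ)) ≠
        r • (Θ.mulVec (fun j => (x j : ℝ)) - (fun i => (y i : ℝ)))) :
    ∃ (u : Fin n → ℤ) (w : Fin m → ℤ), (u ≠ 0 ∨ w ≠ 0) ∧
      ‖(fun i => (u i : ℝ))‖ ≤ (m + n) * H ∧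
      ‖Θ.transpose.mulVec (fun i => (u i : ℝ)) - (fun j => (w j : ℝ))‖ ≤ (m + n) * R := by
  set B : Matrix (Fin m ⊕ Fin n) (Fin m ⊕ Fin n) ℝ :=
    Matrix.fromBlocks (-1) Θ.transpose 0 1 with hB
  have hdet : |B.det| = 1 := by
    rw [hB, Matrix.det_fromBlocks_zero₂₁, Matrix.det_one, mul_one, Matrix.det_neg, Matrix.det_one]
    simp
  have hBz : ∀ z : Fin m ⊕ Fin n → ℤ, B.mulVec (fun j => (z j : ℝ)) =
      Sum.elim (Θ.transpose.mulVec (fun i => (z (Sum.inr i) : ℝ)) -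
        (fun j => (z (Sum.inl j) : ℝ))) (fun i => (z (Sum.inr i) : ℝ)) := fun z => by
    rw [hB, Matrix.fromBlocks_mulVec]
    simp [Function.comp_def, sub_eq_neg_add, Matrix.neg_mulVec]
  have hint : ∀ (x : Fin m → ℤ) (y : Fin n → ℤ) (z : Fin m ⊕ Fin n → ℤ), ∃ k : ℤ,
      Sum.elim (fun j => (x j : ℝ))
        (-(Θ.mulVec (fun j => (x j : ℝ)) - (fun i => (y i : ℝ)))) ⬝ᵥ
        B.mulVec (fun j => (z j : ℝ)) = k := fun x y z => by
    refine ⟨∑ i, y i * z (Sum.inr i) - ∑ j, x j * z (Sum.inl j), ?_⟩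
    rw [hBz, sumElim_dotProduct_sumElim, dotProduct_sub, neg_dotProduct, sub_dotProduct,
      Matrix.mulVec_transpose, dotProduct_comm _ (Matrix.vecMul _ _), ← Matrix.dotProduct_mulVec,
      dotProduct_comm _ (Θ.mulVec _)]
    simp only [dotProduct]
    push_cast
    ring
  set v := Sum.elim (fun j => (x j : ℝ))
        (-(Θ.mulVec (fun j => (x j : ℝ)) - (fun i => (y i : ℝ)))) with hv
  set v' := Sum.elim (fun j => (x' j : ℝ))
        (-(Θ.mulVec (fun j => (x' j : ℝ)) - (fun i => (y' i : ℝ)))) with hv'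
  set s : Fin m ⊕ Fin n → ℝ := Sum.elim (fun _ => R) (fun _ => H) with hs
  have hs0 : ∀ i, 0 < s i := by rintro (i | i) <;> assumption
  have hU0 : 0 ≤ U := (norm_nonneg _).trans hU
  have hX0 : 0 ≤ X := (norm_nonneg _).trans hxX
  have hvs : ∀ i, |v i| * s i ≤ U * H := by
    rintro (i | i)
    · rw [← hXR]
      exact mul_le_mul_of_nonneg_right ((norm_le_pi_norm (fun j => (x j : ℝ)) i).trans hxX) hR.le
    · refine mul_le_mul_of_nonneg_right ?_ hH.le
      simp only [hv, Sum.elim_inr, Pi.neg_apply, abs_neg]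
      exact (norm_le_pi_norm _ i).trans hU
  have hvs' : ∀ i, |v' i| * s i ≤ X' * R := by
    rintro (i | i)
    · exact mul_le_mul_of_nonneg_right ((norm_le_pi_norm (fun j => (x' j : ℝ)) i).trans hxX') hR.le
    · refine le_trans ?_ (hXR.symm.le.trans (mul_le_mul_of_nonneg_right hXX' hR.le))
      refine mul_le_mul_of_nonneg_right ?_ hH.le
      simp only [hv', Sum.elim_inr, Pi.neg_apply, abs_neg]
      exact (norm_le_pi_norm _ i).trans hU'
  obtain ⟨z, hz0, hz⟩ := exists_lattice_point_of_plucker_lt B hdet v v' (hint x y) (hint x' y')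
    (by
      by_contra! hcon
      obtain ⟨j, hj⟩ := Function.ne_iff.1 hx
      have hj' : (x j : ℝ) ≠ 0 := by exact_mod_cast hj
      have hprop : ∀ i, v' i = x' j / x j * v i := fun i => by
        have := hcon (Sum.inl j) i
        simp only [hv, hv', Sum.elim_inl] at this ⊢
        field_simp
        linarith
      refine hind (x' j / x j) (funext fun i => hprop (Sum.inl i)) (funext fun i => ?_)
      have := hprop (Sum.inr i)
      simp only [hv, hv', Sum.elim_inr, Pi.neg_apply, mul_neg, neg_inj] at this
      exact this)
    s hs0 (fun i j _ => by
      have hprod : ∏ k, s k = R ^ m * H ^ n := by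
        simp [hs, Fintype.prod_sum_type]
      rw [hprod]
      refine lt_of_le_of_lt ?_ hvol
      have h1 : ∀ i j, |v i * v' j| * (s i * s j) ≤ (U * H) * (X' * R) := fun i j => by
        rw [abs_mul, mul_mul_mul_comm]
        exact mul_le_mul (hvs i) (hvs' j) (mul_nonneg (abs_nonneg _) (hs0 j).le) (by positivity)
      calc _ ≤ (|v i * v' j| + |v j * v' i|) * (s i * s j) :=
            mul_le_mul_of_nonneg_right (abs_sub _ _) (mul_pos (hs0 i) (hs0 j)).le
        _ = |v i * v' j| * (s i * s j) + |v j * v' i| * (s j * s i) := by ring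
        _ ≤ (U * H) * (X' * R) + (U * H) * (X' * R) := add_le_add (h1 i j) (h1 j i)
        _ = _ := by ring)
  rw [hBz] at hz
  have hcard : (Fintype.card (Fin m ⊕ Fin n) : ℝ) = m + n := by simp
  rw [hcard] at hz
  refine ⟨fun i => z (Sum.inr i), fun j => z (Sum.inl j), ?_, ?_, ?_⟩
  · by_contra! hcon
    exact hz0 (funext (Sum.rec (fun j => congrFun hcon.2 j) (fun i => congrFun hcon.1 i)))
  · exact (pi_norm_le_iff_of_nonneg (by positivity)).2 fun i => hz (Sum.inr i)
  · exact (pi_norm_le_iff_of_nonneg (by positivity)).2 fun j => hz (Sum.inl j)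

/-- Transference from uniform exponent `a⁻¹` and individual exponent `b⁻¹` of `Θ` to the
individual exponent of `Θᵀ`. -/
theorem indivApprox_transpose {n m : ℕ} (hn : 0 < n) (hm : 0 < m) (hnm : ¬(n = 1 ∧ m = 1))
    {Θ : Matrix (Fin n) (Fin m) ℝ} (hβ : betaExp n m Θ ≠ ⊤) {a b γ : ℝ} (hb : 0 < b)
    (hba : b ≤ a) (hγ : 0 < γ) (hu : UniformlyApprox n m Θ (fun t => t ^ (-a⁻¹)))
    (hi : IndivApprox n m Θ (fun t => t ^ (-b⁻¹)))
    (hN : 0 < ((n : ℝ) - 1) * (1 + b) - (a - 1))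
    (hND : γ * (((m : ℝ) - 1) * (1 + b) + (a - 1)) < ((n : ℝ) - 1) * (1 + b) - (a - 1)) :
    IndivApprox m n Θ.transpose (fun t => t ^ (-γ)) := by
  have ha : 0 < a := hb.trans_le hba
  have hd3 : 3 ≤ m + n := by omega
  set d : ℝ := n + m - 2 with hd
  have hd0 : 0 < d := by
    have : (3 : ℝ) ≤ m + n := by exact_mod_cast hd3
    linarith
  set N : ℝ := ((n : ℝ) - 1) * (1 + b) - (a - 1) with hNdef
  set D : ℝ := ((m : ℝ) - 1) * (1 + b) + (a - 1) with hDdef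
  set c : ℝ := m + n with hc
  have hc0 : 0 < c := by linarith
  refine indivApprox_of_forall_small fun ε hε => ?_
  have hRsmall : Tendsto (fun τ : ℝ => c * (5 * τ ^ (-(N / d)))) atTop (nhds 0) := by
    have := ((tendsto_rpow_neg_atTop (div_pos hN hd0)).const_mul 5).const_mul c
    simpa using this
  have hquot : ∀ᶠ τ : ℝ in atTop,
      c * (5 * τ ^ (-(N / d))) ≤ (c * (5 * τ ^ (D / d))) ^ (-γ) := by
    have hlim := (tendsto_rpow_neg_atTop (div_pos (sub_pos.2 hND) hd0)).const_mul (c * 5)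
    rw [mul_zero] at hlim
    have hpos : 0 < (c * 5) ^ (-γ) := by positivity
    filter_upwards [hlim.eventually_lt_const hpos, eventually_gt_atTop 0] with τ hτ hτ0
    have h1 : (c * (5 * τ ^ (D / d))) ^ (-γ) = (c * 5) ^ (-γ) * τ ^ (-(γ * D / d)) := by
      rw [← mul_assoc, Real.mul_rpow (by positivity) (by positivity), ← Real.rpow_mul hτ0.le]
      congr 2
      ring
    have h2 : c * (5 * τ ^ (-(N / d))) =
        c * 5 * τ ^ (-((N - γ * D) / d)) * τ ^ (-(γ * D / d)) := by
      rw [← mul_assoc, mul_assoc (c * 5) (τ ^ _), ← Real.rpow_add hτ0]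
      congr 2
      ring
    rw [h1, h2]
    exact mul_le_mul_of_nonneg_right hτ.le (by positivity)
  have hunif := (((tendsto_rpow_atTop ha).const_mul_atTop (two_pos : (0 : ℝ) < 2))).eventually hu
  obtain ⟨T, hT⟩ := eventually_atTop.1 ((hRsmall.eventually_lt_const hε).and
    ((hRsmall.eventually_lt_const one_pos).and (hquot.and (hunif.and (eventually_ge_atTop 1)))))
  obtain ⟨x₀, y₀, hx₀, hle₀, hlt₀⟩ := hi.exists_small (inv_pos.2 hb)
    (ε := (max T 1)⁻¹) (by positivity)
  obtain ⟨x, y, hx, hxle, hLle, hmin⟩ := exists_minimal_pair Θ x₀ y₀ hx₀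
  have hU0 := residual_ne_zero_of_betaExp_ne_top hβ hx y
  have hL0 := residual_ne_zero_of_betaExp_ne_top hβ hx₀ y₀
  set U := ‖Θ.mulVec (fun j => (x j : ℝ)) - (fun i => (y i : ℝ))‖ with hU
  set τ := U⁻¹ with hτ
  have hUτ : U = τ ^ (-1 : ℝ) := by rw [Real.rpow_neg_one, hτ, inv_inv]
  have hτT : T ≤ τ :=
    (le_max_left T 1).trans ((le_inv_comm₀ (by positivity) hU0).2 (hLle.trans hlt₀.le))
  obtain ⟨hRε, hR1, hRH, ⟨x', y', hx', hxX', hxy'⟩, hτ1⟩ := hT τ hτT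
  have hτ0 : 0 < τ := by linarith
  have hxX : ‖(fun j => (x j : ℝ))‖ ≤ τ ^ b := by
    refine hxle.trans ?_
    have h1 := one_le_norm_intCast hx₀
    have h2 : ‖(fun j => (x₀ j : ℝ))‖ ≤
        ‖Θ.mulVec (fun j => (x₀ j : ℝ)) - (fun i => (y₀ i : ℝ))‖ ^ (-b⁻¹)⁻¹ :=
      (Real.le_rpow_inv_iff_of_neg (by linarith) hL0 (neg_lt_zero.2 (inv_pos.2 hb))).2 hle₀
    refine h2.trans ?_
    rw [inv_neg, inv_inv, hτ, Real.inv_rpow hU0.le, ← Real.rpow_neg hU0.le]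
    exact Real.rpow_le_rpow_of_nonpos hU0 hLle (by linarith)
  have hxyU : ‖Θ.mulVec (fun j => (x' j : ℝ)) - (fun i => (y' i : ℝ))‖ < U := by
    refine hxy'.trans_lt ?_
    beta_reduce
    rw [Real.mul_rpow (by norm_num) (by positivity), ← Real.rpow_mul hτ0.le, mul_neg,
      mul_inv_cancel₀ ha.ne', ← hUτ]
    exact mul_lt_of_lt_one_left hU0
      (Real.rpow_lt_one_of_one_lt_of_neg one_lt_two (neg_lt_zero.2 (inv_pos.2 ha)))
  obtain ⟨u, w, huw, huH, huR⟩ := exists_dual_pair Θ (H := 5 * τ ^ (D / d))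
    (R := 5 * τ ^ (-(N / d))) hx hxX hxX' hU.symm.le hxyU.le
    (by
      have h1 := Real.rpow_le_rpow_of_exponent_le hτ1 hba
      have h2 : 0 < τ ^ a := by positivity
      linarith)
    (by positivity) (by positivity)
    (by
      rw [hUτ, mul_left_comm, mul_left_comm _ 5, ← Real.rpow_add hτ0, ← Real.rpow_add hτ0]
      congr 2
      field_simp
      rw [hNdef, hDdef, hd]
      ring)
    (by
      have h5 : (5 : ℝ) ^ 3 ≤ 5 ^ (m + n) := pow_le_pow_right₀ (by norm_num) hd3
      have hL : 2 * (2 * τ ^ a) * U * (5 * τ ^ (D / d)) * (5 * τ ^ (-(N / d))) =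
          100 * τ ^ (a - 1 + (D - N) / d) := by
        have : a - 1 + (D - N) / d = a + -1 + D / d + -(N / d) := by ring
        rw [this, Real.rpow_add hτ0, Real.rpow_add hτ0, Real.rpow_add hτ0, hUτ]
        ring
      have hRt : (5 * τ ^ (-(N / d))) ^ m * (5 * τ ^ (D / d)) ^ n =
          5 ^ (m + n) * τ ^ (a - 1 + (D - N) / d) := by
        have : a - 1 + (D - N) / d = -(N / d) * m + D / d * n := by
          field_simp
          rw [hNdef, hDdef, hd]
          ring
        rw [this, Real.rpow_add hτ0, Real.rpow_mul_natCast hτ0.le, Real.rpow_mul_natCast hτ0.le]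
        ring
      rw [hL, hRt]
      exact mul_lt_mul_of_pos_right (by linarith) (by positivity))
    (by
      intro r hr1 hr2
      rw [hr2, norm_smul] at hxyU
      have hr : ‖r‖ < 1 := by
        refine lt_of_mul_lt_mul_right ?_ hU0.le
        rw [one_mul]
        exact hxyU
      have hle : ‖(fun j => (x' j : ℝ))‖ ≤ ‖(fun j => (x j : ℝ))‖ := by
        rw [hr1, norm_smul]
        exact mul_le_of_le_one_left (norm_nonneg _) hr.le
      have := hmin x' y' hx' hle
      rw [hr2, norm_smul] at this
      exact absurd hxyU (not_lt.2 this))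
  have hu0 : u ≠ 0 := by
    rintro rfl
    have hw := huw.resolve_left (fun h => h rfl)
    have h1 := one_le_norm_intCast hw
    have h2 := huR.trans_lt hR1
    simp only [Pi.zero_apply, Int.cast_zero] at h2
    rw [← Pi.zero_def, Matrix.mulVec_zero, zero_sub, norm_neg] at h2
    linarith
  have h1 := one_le_norm_intCast hu0
  exact ⟨u, w, hu0, (huR.trans hRH).trans
    (Real.rpow_le_rpow_of_nonpos (by linarith) huH (by linarith)), huR.trans_lt hRε⟩

theorem ofReal_le_betaExp_transpose {n m : ℕ} (hn : 0 < n) (hm : 0 < m)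
    (hnm : ¬(n = 1 ∧ m = 1)) {Θ : Matrix (Fin n) (Fin m) ℝ}
    (hα : alphaExp n m Θ ≠ ⊤) (hβ : betaExp n m Θ ≠ ⊤) {γ : ℝ} (hγ : 0 < γ)
    (hN : 0 < ((n : ℝ) - 1) * (1 + ((betaExp n m Θ).toReal)⁻¹) -
      (((alphaExp n m Θ).toReal)⁻¹ - 1))
    (hND : γ * (((m : ℝ) - 1) * (1 + ((betaExp n m Θ).toReal)⁻¹) +
        (((alphaExp n m Θ).toReal)⁻¹ - 1)) <
      ((n : ℝ) - 1) * (1 + ((betaExp n m Θ).toReal)⁻¹) - (((alphaExp n m Θ).toReal)⁻¹ - 1)) :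
    ENNReal.ofReal γ ≤ betaExp m n Θ.transpose := by
  have hα0 : 0 < (alphaExp n m Θ).toReal := ENNReal.toReal_pos (alphaExp_pos hn hm Θ).ne' hα
  have hαβ : (alphaExp n m Θ).toReal ≤ (betaExp n m Θ).toReal :=
    ENNReal.toReal_mono hβ (alphaExp_le_betaExp Θ)
  have hof : ∀ {E : ℝ≥0∞} {e : ℝ}, 0 < E.toReal → E ≠ ⊤ → 0 < e →
      ENNReal.ofReal (E.toReal⁻¹ + e)⁻¹ < E := fun {E e} h0 hE he => by
    rw [ENNReal.ofReal_lt_iff_lt_toReal (by positivity) hE, inv_lt_comm₀ (by positivity) h0]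
    linarith
  set α := (alphaExp n m Θ).toReal
  set β := (betaExp n m Θ).toReal
  have hβ0 : 0 < β := hα0.trans_le hαβ
  set N : ℝ := ((n : ℝ) - 1) * (1 + β⁻¹) - (α⁻¹ - 1) with hNdef
  set D : ℝ := ((m : ℝ) - 1) * (1 + β⁻¹) + (α⁻¹ - 1) with hDdef
  have hn1 : (1 : ℝ) ≤ n := by exact_mod_cast hn
  set e := min (N - γ * D) N / (2 * (1 + γ * m)) with he
  have hγm : 0 ≤ γ * m := by positivity
  have hmin : 0 < min (N - γ * D) N := lt_min (sub_pos.2 hND) hN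
  have he0 : 0 < e := by positivity
  have he1 : e * (1 + γ * m) < min (N - γ * D) N := by
    have : e * (1 + γ * m) = min (N - γ * D) N / 2 := by rw [he]; field_simp
    linarith
  have he2 := he1.trans_le (min_le_left _ _)
  have he3 := he1.trans_le (min_le_right _ _)
  have hen : 0 ≤ e * ((n : ℝ) - 1) := mul_nonneg he0.le (by linarith)
  have heγ : 0 ≤ e * (γ * m) := mul_nonneg he0.le hγm
  have hN' : ((n : ℝ) - 1) * (1 + (β⁻¹ + e)) - (α⁻¹ + e - 1) = N + e * ((n : ℝ) - 1) - e := by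
    rw [hNdef]; ring
  have hD' : ((m : ℝ) - 1) * (1 + (β⁻¹ + e)) + (α⁻¹ + e - 1) = D + e * m := by
    rw [hDdef]; ring
  refine le_betaExp hγ (indivApprox_transpose hn hm hnm hβ (a := α⁻¹ + e) (b := β⁻¹ + e)
    (by positivity) ?_ hγ (uniformlyApprox_of_lt_alphaExp (hof hα0 hα he0))
    (indivApprox_of_lt_betaExp (by positivity) (hof hβ0 hβ he0)) ?_ ?_)
  · have := inv_anti₀ hα0 hαβ
    linarith
  · rw [hN']
    nlinarith
  · rw [hN', hD']
    nlinarith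

/-- Inequality (3) of German's Theorem 3: a refinement of Dyson's transference
inequality taking the uniform exponent into account (the `k = -1` case). Here
`α(Θ), β(Θ) < ∞`, the numerator and denominator are computed in `ℝ` and the
quotient is taken in `ℝ≥0∞` (so that `a/0 = +∞` for `a > 0`). -/
theorem individual_exponent_transference_three (n m : ℕ) (hn : 0 < n) (hm : 0 < m)
    (hnm : ¬(n = 1 ∧ m = 1)) (Θ : Matrix (Fin n) (Fin m) ℝ)
    (hα : alphaExp n m Θ ≠ ⊤) (hβ : betaExp n m Θ ≠ ⊤) :
    ENNReal.ofReal
        (((n : ℝ) - 1) * (1 + ((betaExp n m Θ).toReal)⁻¹) -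
          (((alphaExp n m Θ).toReal)⁻¹ - 1)) /
      ENNReal.ofReal
        (((m : ℝ) - 1) * (1 + ((betaExp n m Θ).toReal)⁻¹) +
          (((alphaExp n m Θ).toReal)⁻¹ - 1)) ≤
      betaExp m n Θ.transpose := by
  set N : ℝ := ((n : ℝ) - 1) * (1 + ((betaExp n m Θ).toReal)⁻¹) -
    (((alphaExp n m Θ).toReal)⁻¹ - 1) with hN
  set D : ℝ := ((m : ℝ) - 1) * (1 + ((betaExp n m Θ).toReal)⁻¹) +
    (((alphaExp n m Θ).toReal)⁻¹ - 1) with hD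
  have key : ∀ γ : ℝ, 0 < γ → 0 < N → γ * D < N →
      ENNReal.ofReal γ ≤ betaExp m n Θ.transpose := fun γ hγ h1 h2 =>
    ofReal_le_betaExp_transpose hn hm hnm hα hβ hγ h1 h2
  rcases le_or_gt N 0 with hN0 | hN0
  · rw [ENNReal.ofReal_of_nonpos hN0, ENNReal.zero_div]
    exact zero_le
  rcases le_or_gt D 0 with hD0 | hD0
  · rw [ENNReal.eq_top_of_forall_nnreal_le (x := betaExp m n Θ.transpose) fun r => ?_]
    · exact le_top
    have hr : (r : ℝ≥0∞) ≤ ENNReal.ofReal (r + 1) := by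
      rw [← ENNReal.ofReal_coe_nnreal]
      exact ENNReal.ofReal_le_ofReal (by linarith)
    have hr1 : (0 : ℝ) < r + 1 := by positivity
    exact hr.trans (key _ hr1 hN0 (by nlinarith))
  · rw [← ENNReal.ofReal_div_of_pos hD0]
    refine le_of_forall_lt fun e he => ?_
    have he' := (ENNReal.lt_ofReal_iff_toReal_lt he.ne_top).1 he
    have he0 : 0 ≤ e.toReal := ENNReal.toReal_nonneg
    set γ := (e.toReal + N / D) / 2 with hγ
    have h1 : 0 < γ := by linarith
    refine lt_of_lt_of_le ((ENNReal.lt_ofReal_iff_toReal_lt he.ne_top).2 ?_)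
      (key γ h1 hN0 ((lt_div_iff₀ hD0).1 ?_)) <;> linarith
end
end

section
/- Let n = 1, m = 2, and let Θ be a 1×2 real matrix. Let ψ : ℝ_{>0} → ℝ_{>0} be a decreasing bijection such that f(t) = t·ψ(t) is increasing and invertible, with inverse f⁻. If ᵗΘ is uniformly ψ-approximable, then Θ is uniformly φ-approximable, where φ(t) = 2/(3·f⁻(t/2)). -/
open Filter MeasureTheory
open scoped ENNReal RealInnerProductSpace

noncomputable section

theorem volume_box_inter_strip_ge {r w κ : ℝ} (hw : 0 < w) (hwr : w ≤ r) (hκ : |κ| ≤ 1) :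
    ENNReal.ofReal (4 * w * r - w ^ 2) ≤
      volume {p : ℝ × ℝ | |p.1| ≤ r ∧ |p.2| ≤ r ∧ |κ * p.1 + p.2| ≤ w} := by
  set f : ℝ → ℝ := fun x => max (-r) (-w - κ * x) with hf
  set g : ℝ → ℝ := fun x => min r (w - κ * x) with hg
  have hfc : Continuous f := by fun_prop
  have hgc : Continuous g := by fun_prop
  have hκx : ∀ x, |κ * x| ≤ |x| := fun x => by
    rw [abs_mul]; exact mul_le_of_le_one_left (abs_nonneg _) hκ
  have key : ∀ x, min (2 * w) (r + w - |x|) ≤ g x - f x := by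
    intro x
    have h := abs_le.1 (hκx x)
    simp only [hf, hg]
    rcases max_cases (-r) (-w - κ * x) with h1 | h1 <;>
    rcases min_cases r (w - κ * x) with h2 | h2 <;>
    rcases min_cases (2 * w) (r + w - |x|) with h3 | h3 <;> linarith
  have hle : ∀ x ∈ Set.Icc (-r) r, f x ≤ g x := by
    intro x hx
    have h1 := key x
    have h2 : |x| ≤ r := abs_le.2 hx
    have h3 : 0 ≤ min (2 * w) (r + w - |x|) := le_min (by linarith) (by linarith)
    linarith
  have hsub : regionBetween f g (Set.Icc (-r) r) ⊆
      {p : ℝ × ℝ | |p.1| ≤ r ∧ |p.2| ≤ r ∧ |κ * p.1 + p.2| ≤ w} := by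
    rintro ⟨x, y⟩ ⟨hx, hy1, hy2⟩
    simp only [hf, hg, max_lt_iff, lt_min_iff] at hy1 hy2
    refine ⟨abs_le.2 hx, abs_le.2 ⟨?_, ?_⟩, abs_le.2 ⟨?_, ?_⟩⟩ <;> simp only <;> linarith
  refine le_trans ?_ (measure_mono hsub)
  rw [Measure.volume_eq_prod,
    volume_regionBetween_eq_integral (hfc.integrableOn_Icc) (hgc.integrableOn_Icc)
    measurableSet_Icc hle]
  apply ENNReal.ofReal_le_ofReal
  rw [integral_Icc_eq_integral_Ioc, ← intervalIntegral.integral_of_le (by linarith)]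
  have hc : Continuous (g - f) := hgc.sub hfc
  have hi : ∀ a b, IntervalIntegrable (g - f) volume a b := fun a b => hc.intervalIntegrable a b
  rw [← intervalIntegral.integral_add_adjacent_intervals (hi (-r) (-(r - w))) (hi _ r),
    ← intervalIntegral.integral_add_adjacent_intervals (hi (-(r - w)) (r - w)) (hi _ r)]
  have i1 : ∫ x in (-r)..(-(r - w)), (r + w + x) ≤ ∫ x in (-r)..(-(r - w)), (g - f) x := by
    refine intervalIntegral.integral_mono_on (by linarith)
      ((by fun_prop : Continuous fun x : ℝ => r + w + x).intervalIntegrable _ _) (hi _ _) ?_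
    intro x hx
    refine le_trans (le_min ?_ ?_) (key x)
    · linarith [hx.2]
    · rw [abs_of_nonpos (by linarith [hx.2])]; linarith
  have i2 : ∫ x in (-(r - w))..(r - w), (2 * w) ≤ ∫ x in (-(r - w))..(r - w), (g - f) x := by
    refine intervalIntegral.integral_mono_on (by linarith)
      ((by fun_prop : Continuous fun x : ℝ => 2 * w).intervalIntegrable _ _) (hi _ _) ?_
    intro x hx
    refine le_trans (le_min le_rfl ?_) (key x)
    linarith [abs_le.2 hx]
  have i3 : ∫ x in (r - w)..r, (r + w - x) ≤ ∫ x in (r - w)..r, (g - f) x := by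
    refine intervalIntegral.integral_mono_on (by linarith)
      ((by fun_prop : Continuous fun x : ℝ => r + w - x).intervalIntegrable _ _) (hi _ _) ?_
    intro x hx
    refine le_trans (le_min ?_ ?_) (key x)
    · linarith [hx.1]
    · rw [abs_of_nonneg (by linarith [hx.1])]
  have j1 : ∫ x in (-r)..(-(r - w)), (r + w + x) = (3 / 2) * w ^ 2 := by
    rw [intervalIntegral.integral_add (by simp) (by simp)]
    simp; ring
  have j3 : ∫ x in (r - w)..r, (r + w - x) = (3 / 2) * w ^ 2 := by
    rw [intervalIntegral.integral_sub (by simp) (by simp)]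
    simp; ring
  have j2 : ∫ x in (-(r - w))..(r - w), (2 * w) = 4 * w * (r - w) := by
    simp; ring
  rw [j1] at i1
  rw [j2] at i2
  rw [j3] at i3
  nlinarith

theorem exists_vecMul_mem_of_volume_lt (M : Matrix (Fin 2) (Fin 2) ℤ) (hM : 0 < M.det)
    {s : Set (Fin 2 → ℝ)} (hsymm : ∀ x ∈ s, -x ∈ s) (hconv : Convex ℝ s)
    (hs : ENNReal.ofReal (4 * M.det) < volume s) :
    ∃ v : Fin 2 → ℤ, Matrix.vecMul v M ≠ 0 ∧ (fun i => ((Matrix.vecMul v M i : ℤ) : ℝ)) ∈ s := by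
  set A : Matrix (Fin 2) (Fin 2) ℝ := M.map (Int.cast : ℤ → ℝ) with hA
  have hdet : A.det = (M.det : ℝ) := by
    rw [hA, Matrix.det_fin_two, Matrix.det_fin_two]; simp
  have hdetpos : 0 < A.det := by rw [hdet]; exact_mod_cast hM
  have hli : LinearIndependent ℝ A.row :=
    Matrix.linearIndependent_rows_of_det_ne_zero hdetpos.ne'
  let b := basisOfLinearIndependentOfCardEqFinrank hli (by simp)
  have hb : (b : Fin 2 → Fin 2 → ℝ) = A.row :=
    coe_basisOfLinearIndependentOfCardEqFinrank _ _
  have hof : Matrix.of (b : Fin 2 → Fin 2 → ℝ) = A := by rw [hb]; rfl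
  have hvol : volume (ZSpan.fundamentalDomain b) * 2 ^ Module.finrank ℝ (Fin 2 → ℝ) <
      volume s := by
    rw [ZSpan.volume_fundamentalDomain, hof, abs_of_pos hdetpos, hdet]
    refine lt_of_eq_of_lt ?_ hs
    rw [ENNReal.ofReal_mul (by norm_num), mul_comm]
    simp
    norm_num
  have hcount : Countable (Submodule.span ℤ (Set.range b)).toAddSubgroup :=
    inferInstanceAs (Countable (Submodule.span ℤ (Set.range b)))
  obtain ⟨x, hx0, hxs⟩ := exists_ne_zero_mem_lattice_of_measure_mul_two_pow_lt_measure
    (ZSpan.isAddFundamentalDomain' b volume) hsymm hconv hvol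
  obtain ⟨v, hv⟩ := (Submodule.mem_span_range_iff_exists_fun ℤ).1 x.2
  have hvx : (fun i => ((Matrix.vecMul v M i : ℤ) : ℝ)) = (x : Fin 2 → ℝ) := by
    rw [← hv, hb]
    ext i
    simp [Matrix.vecMul, dotProduct, Fin.sum_univ_two, hA]
  refine ⟨v, fun h => hx0 ?_, hvx ▸ hxs⟩
  ext i
  rw [← hvx, h]
  simp

theorem volume_strip_fin_two_ge {r w κ : ℝ} (hw : 0 < w) (hwr : w ≤ r) (hκ : |κ| ≤ 1) :
    ENNReal.ofReal (4 * w * r - w ^ 2) ≤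
      volume {x : Fin 2 → ℝ | |x 0| ≤ r ∧ |x 1| ≤ r ∧ |κ * x 0 + x 1| ≤ w} := by
  rw [show {x : Fin 2 → ℝ | |x 0| ≤ r ∧ |x 1| ≤ r ∧ |κ * x 0 + x 1| ≤ w} =
      (MeasurableEquiv.finTwoArrow : (Fin 2 → ℝ) ≃ᵐ ℝ × ℝ) ⁻¹'
        {p : ℝ × ℝ | |p.1| ≤ r ∧ |p.2| ≤ r ∧ |κ * p.1 + p.2| ≤ w} from rfl,
    (volume_preserving_finTwoArrow ℝ).measure_preimage_equiv]
  exact volume_box_inter_strip_ge hw hwr hκ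

theorem exists_congruence_matrix (p₀ p₁ q : ℤ) :
    ∃ M : Matrix (Fin 2) (Fin 2) ℤ, M.det = q ∧
      ∀ v : Fin 2 → ℤ, q ∣ p₀ * Matrix.vecMul v M 0 + p₁ * Matrix.vecMul v M 1 := by
  obtain ⟨k, hk⟩ : (Int.gcd p₁ q : ℤ) ∣ q := Int.gcd_dvd_right ..
  obtain ⟨l, hl⟩ : (Int.gcd p₁ q : ℤ) ∣ p₁ := Int.gcd_dvd_left ..
  have hbez := Int.gcd_eq_gcd_ab p₁ q
  set g : ℤ := (Int.gcd p₁ q : ℤ)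
  set u := Int.gcdA p₁ q
  set s := Int.gcdB p₁ q
  refine ⟨!![g, -(u * p₀); 0, k], ?_, fun v => ⟨v 0 * p₀ * s + v 1 * l, ?_⟩⟩
  · rw [Matrix.det_fin_two_of]; linarith
  · simp only [Matrix.vecMul, dotProduct, Fin.sum_univ_two, Matrix.of_apply, Matrix.cons_val_zero,
      Matrix.cons_val_one, Matrix.cons_val', Matrix.cons_val_fin_one]
    linear_combination p₀ * v 0 * hbez + v 1 * k * hl - v 1 * l * hk

theorem exists_congruence_strip_point_of_le (p₀ p₁ : ℤ) {q : ℤ} (hq : 0 < q) {e₀ e₁ r c : ℝ}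
    (he : |e₀| ≤ |e₁|) (he₁ : e₁ ≠ 0) (hr : 0 < r) (hrq : 4 * (q : ℝ) / 3 < r ^ 2)
    (hc : 4 * (q : ℝ) / 3 * |e₁| ≤ r * c) :
    ∃ x₀ x₁ : ℤ, (x₀ ≠ 0 ∨ x₁ ≠ 0) ∧ |(x₀ : ℝ)| ≤ r ∧ |(x₁ : ℝ)| ≤ r ∧
      q ∣ p₀ * x₀ + p₁ * x₁ ∧ |e₀ * x₀ + e₁ * x₁| ≤ c := by
  have hqR : (0 : ℝ) < q := by exact_mod_cast hq
  have hepos : 0 < |e₁| := abs_pos.2 he₁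
  obtain ⟨M, hdet, hM⟩ := exists_congruence_matrix p₀ p₁ q
  set κ := e₀ / e₁ with hκdef
  set w := 4 * (q : ℝ) / 3 / r with hwdef
  have hwr : w * r = 4 * (q : ℝ) / 3 := by rw [hwdef]; field_simp
  have hw : 0 < w := by positivity
  have hwler : w < r := by
    by_contra! h
    nlinarith
  have hκ : |κ| ≤ 1 := by rw [hκdef, abs_div]; exact (div_le_one hepos).2 he
  set s : Set (Fin 2 → ℝ) := {x | |x 0| ≤ r ∧ |x 1| ≤ r ∧ |κ * x 0 + x 1| ≤ w} with hs
  have hsymm : ∀ x ∈ s, -x ∈ s := by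
    rintro x ⟨h0, h1, h2⟩
    refine ⟨by simpa using h0, by simpa using h1, ?_⟩
    rw [← abs_neg]
    convert h2 using 2
    simp only [Pi.neg_apply]; ring
  have hconv : Convex ℝ s := by
    rintro x ⟨hx0, hx1, hx2⟩ y ⟨hy0, hy1, hy2⟩ a b ha hb hab
    have comb : ∀ {X Y B : ℝ}, |X| ≤ B → |Y| ≤ B → |a * X + b * Y| ≤ B := by
      intro X Y B hX hY
      have hX := abs_le.1 hX
      have hY := abs_le.1 hY
      obtain rfl : b = 1 - a := by linarith
      refine abs_le.2 ⟨?_, ?_⟩ <;> nlinarith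
    refine ⟨comb hx0 hy0, comb hx1 hy1, ?_⟩
    convert comb hx2 hy2 using 2
    simp only [Pi.add_apply, Pi.smul_apply, smul_eq_mul]; ring
  have hvol : ENNReal.ofReal (4 * M.det) < volume s := by
    refine lt_of_lt_of_le ?_ (volume_strip_fin_two_ge hw hwler.le hκ)
    rw [hdet, ENNReal.ofReal_lt_ofReal_iff_of_nonneg (by positivity)]
    nlinarith
  obtain ⟨v, hv0, hvs⟩ := exists_vecMul_mem_of_volume_lt M (hdet ▸ hq) hsymm hconv hvol
  obtain ⟨h0, h1, h2⟩ := hvs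
  refine ⟨_, _, ?_, h0, h1, hM v, ?_⟩
  · by_contra! h
    exact hv0 (funext (Fin.forall_fin_two.2 h))
  · have : e₀ * ((Matrix.vecMul v M 0 : ℤ) : ℝ) + e₁ * ((Matrix.vecMul v M 1 : ℤ) : ℝ) =
        e₁ * (κ * ((Matrix.vecMul v M 0 : ℤ) : ℝ) + ((Matrix.vecMul v M 1 : ℤ) : ℝ)) := by
      rw [hκdef]; field_simp
    rw [this, abs_mul]
    have h3 : |e₁| * w ≤ c := by
      refine le_of_mul_le_mul_left ?_ hr
      calc r * (|e₁| * w) = w * r * |e₁| := by ring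
        _ ≤ r * c := by rw [hwr]; exact hc
    exact (mul_le_mul_of_nonneg_left h2 hepos.le).trans h3

theorem exists_congruence_strip_point (p₀ p₁ : ℤ) {q : ℤ} (hq : 0 < q) {e₀ e₁ r c : ℝ}
    (he : 0 < max |e₀| |e₁|) (hr : 0 < r) (hrq : 4 * (q : ℝ) / 3 < r ^ 2)
    (hc : 4 * (q : ℝ) / 3 * max |e₀| |e₁| ≤ r * c) :
    ∃ x₀ x₁ : ℤ, (x₀ ≠ 0 ∨ x₁ ≠ 0) ∧ |(x₀ : ℝ)| ≤ r ∧ |(x₁ : ℝ)| ≤ r ∧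
      q ∣ p₀ * x₀ + p₁ * x₁ ∧ |e₀ * x₀ + e₁ * x₁| ≤ c := by
  rcases le_total |e₀| |e₁| with h | h
  · rw [max_eq_right h] at he hc
    exact exists_congruence_strip_point_of_le p₀ p₁ hq h (abs_pos.1 he) hr hrq hc
  · rw [max_eq_left h] at he hc
    obtain ⟨x₁, x₀, hne, h1, h0, hd, hb⟩ :=
      exists_congruence_strip_point_of_le p₁ p₀ hq h (abs_pos.1 he) hr hrq hc
    exact ⟨x₀, x₁, hne.symm, h0, h1, by rwa [add_comm], by rwa [add_comm]⟩

/-- The distance in the sup-norm from `q • (a, b)` to the nearest integer point. -/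
def distInt (a b : ℝ) (q : ℤ) : ℝ :=
  max |q * a - round (q * a)| |q * b - round (q * b)|

theorem distInt_nonneg (a b : ℝ) (q : ℤ) : 0 ≤ distInt a b q :=
  le_max_of_le_left (abs_nonneg _)

theorem distInt_le {a b B : ℝ} {q : ℤ} (p₀ p₁ : ℤ) (h₀ : |q * a - p₀| ≤ B)
    (h₁ : |q * b - p₁| ≤ B) : distInt a b q ≤ B :=
  max_le ((round_le _ _).trans h₀) ((round_le _ _).trans h₁)

theorem exists_form_point_of_congruence {a b : ℝ} {q : ℤ} {r h : ℝ} (hq : 0 < q)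
    (hζ : 0 < distInt a b q) (hr : 0 < r) (hrq : 4 * (q : ℝ) / 3 < r ^ 2)
    (hh : 4 / 3 * distInt a b q ≤ r * h) :
    ∃ x₀ x₁ y : ℤ, (x₀ ≠ 0 ∨ x₁ ≠ 0) ∧ |(x₀ : ℝ)| ≤ r ∧ |(x₁ : ℝ)| ≤ r ∧
      |a * x₀ + b * x₁ - y| ≤ h := by
  have hqR : (0 : ℝ) < q := by exact_mod_cast hq
  obtain ⟨x₀, x₁, hne, h0, h1, ⟨y, hy⟩, hb⟩ :=
    exists_congruence_strip_point (round (q * a)) (round (q * b)) hq (c := q * h) hζ hr hrq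
      (by change 4 * (q : ℝ) / 3 * distInt a b q ≤ _; nlinarith)
  refine ⟨x₀, x₁, y, hne, h0, h1, ?_⟩
  have hyR : (round (q * a) : ℝ) * x₀ + round (q * b) * x₁ = q * y := by exact_mod_cast hy
  have : (q * a - round (q * a)) * x₀ + (q * b - round (q * b)) * x₁ =
      q * (a * x₀ + b * x₁ - y) := by linear_combination -hyR
  rw [this, abs_mul, abs_of_pos hqR] at hb
  exact le_of_mul_le_mul_left hb hqR

theorem exists_form_point_of_cross {a b : ℝ} {q q' : ℤ} {r h : ℝ} (hq' : 0 < q') (hqq : q' < q)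
    (hζ : 0 < distInt a b q) (hζζ : distInt a b q ≤ distInt a b q')
    (hr : q * distInt a b q' + q' * distInt a b q ≤ r)
    (hh : 2 * distInt a b q * distInt a b q' ≤ h) :
    ∃ x₀ x₁ y : ℤ, (x₀ ≠ 0 ∨ x₁ ≠ 0) ∧ |(x₀ : ℝ)| ≤ r ∧ |(x₁ : ℝ)| ≤ r ∧
      |a * x₀ + b * x₁ - y| ≤ h := by
  have hqR' : (0 : ℝ) < q' := by exact_mod_cast hq'
  have hqqR : (q' : ℝ) < q := by exact_mod_cast hqq
  have hqR : (0 : ℝ) < q := hqR'.trans hqqR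
  have hd : distInt a b q = max |q * a - round (q * a)| |q * b - round (q * b)| := rfl
  have hd' : distInt a b q' = max |q' * a - round (q' * a)| |q' * b - round (q' * b)| := rfl
  set p₀ := round (q * a)
  set p₁ := round (q * b)
  set p₀' := round (q' * a)
  set p₁' := round (q' * b)
  set ζ := distInt a b q
  set ζ' := distInt a b q'
  have e0 : |q * a - p₀| ≤ ζ := hd ▸ le_max_left _ _
  have e1 : |q * b - p₁| ≤ ζ := hd ▸ le_max_right _ _
  have e0' : |q' * a - p₀'| ≤ ζ' := hd' ▸ le_max_left _ _
  have e1' : |q' * b - p₁'| ≤ ζ' := hd' ▸ le_max_right _ _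
  have cross : ∀ {u v u' v' A B A' B' : ℝ}, |u| ≤ A → |v| ≤ B → |u'| ≤ A' → |v'| ≤ B' →
      |u * v' - u' * v| ≤ A * B' + A' * B := by
    intro u v u' v' A B A' B' h1 h2 h3 h4
    refine (abs_sub _ _).trans ?_
    rw [abs_mul, abs_mul]
    have := (abs_nonneg u).trans h1
    have := (abs_nonneg u').trans h3
    gcongr
  have aq : |(q : ℝ)| ≤ q := (abs_of_pos hqR).le
  have aq' : |(q' : ℝ)| ≤ q' := (abs_of_pos hqR').le
  refine ⟨q * p₁' - q' * p₁, q' * p₀ - q * p₀', p₀ * p₁' - p₀' * p₁, ?_, ?_, ?_, ?_⟩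
  · by_contra! hx
    obtain ⟨hx1, hx0⟩ := hx
    have hx1R : (q : ℝ) * p₁' = q' * p₁ := by exact_mod_cast sub_eq_zero.1 hx1
    have hx0R : (q' : ℝ) * p₀ = q * p₀' := by exact_mod_cast sub_eq_zero.1 hx0
    have h0 : q * |q' * a - p₀'| ≤ q' * ζ := by
      rw [← abs_of_pos hqR, ← abs_mul,
        show (q : ℝ) * (q' * a - p₀') = q' * (q * a - p₀) by linear_combination hx0R, abs_mul,
        abs_of_pos hqR']
      gcongr
    have h1 : q * |q' * b - p₁'| ≤ q' * ζ := by
      rw [← abs_of_pos hqR, ← abs_mul,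
        show (q : ℝ) * (q' * b - p₁') = q' * (q * b - p₁) by linear_combination -hx1R, abs_mul,
        abs_of_pos hqR']
      gcongr
    have h2 : q * ζ' ≤ q' * ζ := by
      rw [hd', mul_max_of_nonneg _ _ hqR.le]; exact max_le h0 h1
    nlinarith
  · refine le_trans ?_ hr
    have hx : -((q * p₁' - q' * p₁ : ℤ) : ℝ) = q * (q' * b - p₁') - q' * (q * b - p₁) := by
      push_cast; ring
    rw [← abs_neg, hx]
    exact cross aq e1 aq' e1'
  · refine le_trans ?_ hr
    have hx : ((q' * p₀ - q * p₀' : ℤ) : ℝ) = q * (q' * a - p₀') - q' * (q * a - p₀) := by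
      push_cast; ring
    rw [hx]
    exact cross aq e0 aq' e0'
  · refine le_trans ?_ hh
    have hx : -(a * ((q * p₁' - q' * p₁ : ℤ) : ℝ) + b * ((q' * p₀ - q * p₀' : ℤ) : ℝ) -
        ((p₀ * p₁' - p₀' * p₁ : ℤ) : ℝ)) =
        (q * a - p₀) * (q' * b - p₁') - (q' * a - p₀') * (q * b - p₁) := by
      push_cast; ring
    rw [← abs_neg, hx, show 2 * ζ * ζ' = ζ * ζ' + ζ' * ζ by ring]
    exact cross e0 e1 e0' e1'

theorem exists_distInt_minimizer (a b : ℝ) {N : ℤ} (hN : 1 ≤ N) :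
    ∃ q : ℤ, 1 ≤ q ∧ q ≤ N ∧ ∀ k : ℤ, 1 ≤ k → k ≤ N → distInt a b q ≤ distInt a b k := by
  obtain ⟨q, hq, hmin⟩ := Finset.exists_min_image (Finset.Icc 1 N) (distInt a b)
    ⟨1, Finset.mem_Icc.2 ⟨le_rfl, hN⟩⟩
  rw [Finset.mem_Icc] at hq
  exact ⟨q, hq.1, hq.2, fun k h1 h2 => hmin k (Finset.mem_Icc.2 ⟨h1, h2⟩)⟩

/-- The transference step at a single parameter `T`, assuming that the minimizer of the distance to
the integers up to `T` exceeds the threshold `T₀` of uniform approximability. -/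
theorem exists_form_point_of_uniform {a b : ℝ} {ψ : ℝ → ℝ} {T₀ T : ℝ}
    (hψanti : StrictAntiOn ψ (Set.Ioi 0)) (hψbij : Set.BijOn ψ (Set.Ioi 0) (Set.Ioi 0))
    (hf : StrictMonoOn (fun t => t * ψ t) (Set.Ioi 0)) (hT₀ : 1 ≤ T₀)
    (hunif : ∀ t ≥ T₀, ∃ q : ℤ, 1 ≤ q ∧ (q : ℝ) ≤ t ∧ distInt a b q ≤ ψ t)
    (hirr : ∀ q : ℤ, 1 ≤ q → 0 < distInt a b q) (hT : T₀ ≤ T)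
    (hlarge : ∀ q : ℤ, 1 ≤ q → (q : ℝ) ≤ T₀ → ψ T < distInt a b q) :
    ∃ x₀ x₁ y : ℤ, (x₀ ≠ 0 ∨ x₁ ≠ 0) ∧ |(x₀ : ℝ)| ≤ 2 * (T * ψ T) ∧
      |(x₁ : ℝ)| ≤ 2 * (T * ψ T) ∧ |a * x₀ + b * x₁ - y| ≤ 2 / (3 * T) := by
  have hTpos : 0 < T := by linarith
  have hψT : 0 < ψ T := hψbij.mapsTo hTpos
  obtain ⟨q, hq1, hqT, hqmin⟩ := exists_distInt_minimizer a b
    (N := ⌊T⌋) (Int.le_floor.2 (by push_cast; linarith))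
  replace hqT : (q : ℝ) ≤ T := Int.le_floor.1 hqT
  have hqψ : distInt a b q ≤ ψ T := by
    obtain ⟨k, hk1, hkT, hk⟩ := hunif T hT
    exact (hqmin k hk1 (Int.le_floor.2 hkT)).trans hk
  have hqT₀ : T₀ < q := by
    by_contra! h
    exact (hlarge q hq1 h).not_ge hqψ
  have hqpos : (0 : ℝ) < q := by linarith
  have hq2 : 1 < q := by exact_mod_cast hT₀.trans_lt hqT₀
  obtain ⟨q', hq'1, hq'q, hq'min⟩ := exists_distInt_minimizer a b (N := q - 1) (by omega)
  have hq'lt : q' < q := by omega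
  have hq'R : (q' : ℝ) < q := by exact_mod_cast hq'lt
  have hζζ : distInt a b q ≤ distInt a b q' :=
    hqmin q' hq'1 (Int.le_floor.2 (hq'R.le.trans hqT))
  have hψq : distInt a b q' ≤ ψ q := by
    by_contra! h
    have hlt : ψ q < ψ T₀ := hψanti (Set.mem_Ioi.2 (by linarith)) hqpos hqT₀
    obtain ⟨v, hv1, hv2⟩ := exists_between (lt_min h hlt)
    obtain ⟨hv2, hv3⟩ := lt_min_iff.1 hv2
    have hvpos : 0 < v := lt_trans (hψbij.mapsTo hqpos) hv1
    obtain ⟨s, hs, rfl⟩ := hψbij.surjOn hvpos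
    have hsq : s < q := (hψanti.lt_iff_gt hqpos hs).1 hv1
    have hsT₀ : T₀ < s := (hψanti.lt_iff_gt hs (Set.mem_Ioi.2 (by linarith))).1 hv3
    obtain ⟨k, hk1, hks, hk⟩ := hunif s hsT₀.le
    have hkq : k < q := by exact_mod_cast hks.trans_lt hsq
    linarith [hq'min k hk1 (by omega)]
  have hfq : q * ψ q ≤ T * ψ T := hf.monotoneOn hqpos hTpos hqT
  have hζ := hirr q hq1
  have hζ' := hirr q' hq'1
  have hqζ' : q * distInt a b q' ≤ T * ψ T :=
    (mul_le_mul_of_nonneg_left hψq hqpos.le).trans hfq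
  have hTζ : T * distInt a b q ≤ T * ψ T := mul_le_mul_of_nonneg_left hqψ hTpos.le
  have hfpos : 0 < T * ψ T := mul_pos hTpos hψT
  rcases le_or_gt (3 * T * (distInt a b q * distInt a b q')) 1 with hcase | hcase
  · refine exists_form_point_of_cross hq'1 hq'lt hζ hζζ ?_ ?_
    · have : q' * distInt a b q ≤ T * distInt a b q :=
        mul_le_mul_of_nonneg_right (hq'R.le.trans hqT) hζ.le
      linarith
    · rw [le_div_iff₀ (by positivity)]
      linarith
  · refine exists_form_point_of_congruence (q := q) (by omega) hζ (by positivity) ?_ ?_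
    · have h1 : (T * distInt a b q) * (q * distInt a b q') ≤ (T * ψ T) * (T * ψ T) :=
        mul_le_mul hTζ hqζ' (by positivity) hfpos.le
      nlinarith
    · rw [show 2 * (T * ψ T) * (2 / (3 * T)) = 4 / 3 * ψ T by field_simp; norm_num]
      linarith

/-- Part (ii) of German's 3-dimensional Theorem 10 (`n = 1`, `m = 2`): if
`f(t) = t ψ(t)` is increasing and invertible with inverse `f⁻`, and `ᵗΘ` is uniformly
`ψ`-approximable, then `Θ` is uniformly `φ`-approximable with `φ(t) = 2/(3 f⁻(t/2))`. -/
theorem three_dim_transference_case_two (Θ : Matrix (Fin 1) (Fin 2) ℝ)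
    (ψ finv : ℝ → ℝ)
    (hψpos : ∀ t > 0, 0 < ψ t)
    (hψanti : StrictAntiOn ψ (Set.Ioi 0))
    (hψbij : Set.BijOn ψ (Set.Ioi 0) (Set.Ioi 0))
    (hf : StrictMonoOn (fun t => t * ψ t) (Set.Ioi 0))
    (hfbij : Set.BijOn (fun t => t * ψ t) (Set.Ioi 0) (Set.Ioi 0))
    (hfinv : ∀ t > 0, finv (t * ψ t) = t ∧ finv t * ψ (finv t) = t)
    (hΘt : UniformlyApprox 2 1 Θ.transpose ψ) :
    UniformlyApprox 1 2 Θ (fun t => 2 / (3 * finv (t / 2))) := by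
  have hnorm : ∀ {k : ℕ} {v : Fin k → ℝ} {B : ℝ}, 0 ≤ B → (∀ i, |v i| ≤ B) → ‖v‖ ≤ B :=
    fun hB h => (pi_norm_le_iff_of_nonneg hB).2 h
  set a := Θ 0 0
  set b := Θ 0 1
  obtain ⟨T₁, hT₁⟩ := eventually_atTop.1 hΘt
  set T₀ := max T₁ 1
  have hunif : ∀ t ≥ T₀, ∃ q : ℤ, 1 ≤ q ∧ (q : ℝ) ≤ t ∧ distInt a b q ≤ ψ t := by
    intro t ht
    obtain ⟨x, y, hx, hxt, hy⟩ := hT₁ t ((le_max_left _ _).trans ht)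
    have hx0 : x 0 ≠ 0 := fun h => hx (funext fun i => by rw [Subsingleton.elim i 0, h]; rfl)
    have hcoord := fun i => (norm_le_pi_norm _ i).trans hy
    have h0 : |a * x 0 - y 0| ≤ ψ t := by simpa [Matrix.mulVec, dotProduct] using hcoord 0
    have h1 : |b * x 0 - y 1| ≤ ψ t := by simpa [Matrix.mulVec, dotProduct] using hcoord 1
    have hxabs : |(x 0 : ℝ)| ≤ t := (norm_le_pi_norm (fun j => (x j : ℝ)) 0).trans hxt
    rcases lt_or_gt_of_ne hx0 with hneg | hpos
    · refine ⟨-x 0, by omega, ?_, distInt_le (-y 0) (-y 1) ?_ ?_⟩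
      · push_cast; exact (neg_le_abs _).trans hxabs
      · rw [← abs_neg]; convert h0 using 2; push_cast; ring
      · rw [← abs_neg]; convert h1 using 2; push_cast; ring
    · refine ⟨x 0, hpos, (le_abs_self _).trans hxabs, distInt_le (y 0) (y 1) ?_ ?_⟩
      · rwa [mul_comm]
      · rwa [mul_comm]
  have hfinvpos : ∀ t > 0, 0 < finv t ∧ finv t * ψ (finv t) = t := by
    intro t ht
    obtain ⟨s, hs, rfl⟩ := hfbij.surjOn ht
    have h := (hfinv s hs).1
    refine ⟨by rw [h]; exact hs, by rw [h]⟩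
  suffices key : ∀ᶠ t : ℝ in atTop, ∃ x₀ x₁ y : ℤ, (x₀ ≠ 0 ∨ x₁ ≠ 0) ∧ |(x₀ : ℝ)| ≤ t ∧
      |(x₁ : ℝ)| ≤ t ∧ |a * x₀ + b * x₁ - y| ≤ 2 / (3 * finv (t / 2)) by
    filter_upwards [key, eventually_gt_atTop 0] with t ⟨x₀, x₁, y, hne, h0, h1, h⟩ ht
    refine ⟨![x₀, x₁], fun _ => y, ?_, hnorm ht.le (Fin.forall_fin_two.2 ⟨h0, h1⟩),
      hnorm ((abs_nonneg _).trans h) fun i => ?_⟩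
    · intro hx
      rcases hne with h | h
      · exact h (congrFun hx 0)
      · exact h (congrFun hx 1)
    · rw [Subsingleton.elim i 0]
      simpa [Matrix.mulVec, dotProduct, Fin.sum_univ_two] using h
  by_cases hrat : ∃ q : ℤ, 1 ≤ q ∧ distInt a b q = 0
  · obtain ⟨q, hq, hq0⟩ := hrat
    filter_upwards [eventually_gt_atTop 0, eventually_ge_atTop (q : ℝ)] with t ht htq
    have hqa : |q * a - round (q * a)| ≤ 0 := hq0 ▸ le_max_left _ _
    have hqpos : (0 : ℝ) < q := by exact_mod_cast hq
    have hpos := (hfinvpos (t / 2) (by linarith)).1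
    refine ⟨q, 0, round (q * a), Or.inl (by omega), by rwa [abs_of_pos hqpos],
      by simpa using ht.le, ?_⟩
    rw [Int.cast_zero, mul_zero, add_zero, mul_comm a]
    exact hqa.trans (by positivity)
  · have hirr : ∀ q : ℤ, 1 ≤ q → 0 < distInt a b q := fun q hq =>
      lt_of_le_of_ne (distInt_nonneg a b q) fun h => hrat ⟨q, hq, h.symm⟩
    have hT₀ : 1 ≤ T₀ := le_max_right _ _
    obtain ⟨m, hm1, -, hmin⟩ := exists_distInt_minimizer a b
      (N := ⌊T₀⌋) (Int.le_floor.2 (by exact_mod_cast hT₀))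
    obtain ⟨S, hS, hSψ⟩ := hψbij.surjOn (hirr m hm1)
    set R := max T₀ (S + 1)
    have hR : 0 < R := by linarith [le_max_left T₀ (S + 1)]
    filter_upwards [eventually_ge_atTop (2 * (R * ψ R))] with t ht
    have htpos : 0 < t := lt_of_lt_of_le (by have := hψpos R hR; positivity) ht
    obtain ⟨hTpos, hTeq⟩ := hfinvpos (t / 2) (by linarith)
    have hRT : R ≤ finv (t / 2) := (hf.le_iff_le hR hTpos).1 (by
      simp only [hTeq]; linarith)
    have hT := exists_form_point_of_uniform (T := finv (t / 2)) hψanti hψbij hf hT₀ hunif hirr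
      ((le_max_left _ _).trans hRT) fun k hk1 hk =>
        lt_of_lt_of_le (hψanti hS hTpos (by linarith [le_max_right T₀ (S + 1)]))
          (hSψ.trans_le (hmin k hk1 (Int.le_floor.2 hk)))
    rwa [hTeq, mul_div_cancel₀ t two_ne_zero] at hT
end
end

section
/- Let n, m ≥ 1 and d = n + m. For any z₁ = (x₁, y₁) and z₂ = (x₂, y₂) in ℝ^m × ℝ^n = ℝ^d, the area of the parallelogram spanned by z₁ and z₂, namely |z₁ ∧ z₂| = √(|z₁|²|z₂|² − ⟨z₁,z₂⟩²) (Euclidean norms and inner product), satisfies |z₁ ∧ z₂| ≤ √(2d(d−1)) · max( |x₁|_∞ |x₂|_∞ , |y₁|_∞ |y₂|_∞ , max(|x₁|_∞, |x₂|_∞) · max(|y₁|_∞, |y₂|_∞) ). -/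
open Filter MeasureTheory
open scoped ENNReal RealInnerProductSpace

noncomputable section

/-- Lagrange's identity for finite sums, in its symmetric form. -/
theorem two_mul_gram_eq_sum_sq {ι : Type*} [Fintype ι] (a b : ι → ℝ) :
    2 * ((∑ i, a i ^ 2) * (∑ i, b i ^ 2) - (∑ i, a i * b i) ^ 2) =
      ∑ i, ∑ j, (a i * b j - a j * b i) ^ 2 := by
  have h : ∀ i j, (a i * b j - a j * b i) ^ 2 =
      a i ^ 2 * b j ^ 2 + b i ^ 2 * a j ^ 2 - 2 * ((a i * b i) * (a j * b j)) := by
    intro i j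
    ring
  simp only [h, Finset.sum_sub_distrib, Finset.sum_add_distrib, ← Finset.mul_sum,
    ← Finset.sum_mul]
  ring

/-- If all products `a i * b j` are bounded by `M`, then the Gram determinant of `a` and `b`
is at most `2 * d * (d - 1) * M ^ 2`, where `d` is the number of coordinates. -/
theorem gram_le_of_abs_mul_le {ι : Type*} [Fintype ι] (a b : ι → ℝ) {M : ℝ}
    (hM : ∀ i j, |a i * b j| ≤ M) :
    (∑ i, a i ^ 2) * (∑ i, b i ^ 2) - (∑ i, a i * b i) ^ 2 ≤
      2 * (Fintype.card ι : ℝ) * ((Fintype.card ι : ℝ) - 1) * M ^ 2 := by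
  classical
  have h : ∀ i j, (a i * b j - a j * b i) ^ 2 ≤ 4 * M ^ 2 - if i = j then 4 * M ^ 2 else 0 := by
    intro i j
    split_ifs with hij
    · simp [hij]
    · have h₁ := abs_le.mp (hM i j)
      have h₂ := abs_le.mp (hM j i)
      nlinarith
  have hsum := Finset.sum_le_sum fun i (_ : i ∈ Finset.univ) =>
    Finset.sum_le_sum fun j (_ : j ∈ Finset.univ) => h i j
  rw [← two_mul_gram_eq_sum_sq] at hsum
  simp only [Finset.sum_sub_distrib, Finset.sum_ite_eq, Finset.mem_univ, if_true,
    Finset.sum_const, Finset.card_univ, nsmul_eq_mul] at hsum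
  linarith

/-- German's Lemma 6: for `z₁ = (x₁, y₁)` and `z₂ = (x₂, y₂)` in `ℝ^m × ℝ^n = ℝ^d`,
the area `|z₁ ∧ z₂| = √(|z₁|²|z₂|² - ⟨z₁,z₂⟩²)` of the parallelogram they span is at
most `√(2d(d-1)) max(|x₁|_∞|x₂|_∞, |y₁|_∞|y₂|_∞, max(|x₁|_∞,|x₂|_∞)max(|y₁|_∞,|y₂|_∞))`.
(Norms `‖·‖` on `Fin k → ℝ` are sup-norms.) -/
theorem wedge_norm_bound (n m : ℕ) (hn : 1 ≤ n) (hm : 1 ≤ m)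
    (x₁ x₂ : Fin m → ℝ) (y₁ y₂ : Fin n → ℝ) :
    Real.sqrt ((∑ j, x₁ j ^ 2 + ∑ i, y₁ i ^ 2) * (∑ j, x₂ j ^ 2 + ∑ i, y₂ i ^ 2) -
        (∑ j, x₁ j * x₂ j + ∑ i, y₁ i * y₂ i) ^ 2) ≤
      Real.sqrt (2 * ((n : ℝ) + m) * (((n : ℝ) + m) - 1)) *
        max (‖x₁‖ * ‖x₂‖) (max (‖y₁‖ * ‖y₂‖) (max ‖x₁‖ ‖x₂‖ * max ‖y₁‖ ‖y₂‖)) := by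
  set M := max (‖x₁‖ * ‖x₂‖) (max (‖y₁‖ * ‖y₂‖) (max ‖x₁‖ ‖x₂‖ * max ‖y₁‖ ‖y₂‖))
  have hM0 : 0 ≤ M := le_max_of_le_left (by positivity)
  have hbound : ∀ i j, |Sum.elim x₁ y₁ i * Sum.elim x₂ y₂ j| ≤ M := by
    rintro (i | i) (j | j) <;> simp only [Sum.elim_inl, Sum.elim_inr, abs_mul]
    · exact le_max_of_le_left
        (mul_le_mul (norm_le_pi_norm x₁ i) (norm_le_pi_norm x₂ j) (abs_nonneg _) (norm_nonneg _))
    · exact le_max_of_le_right <| le_max_of_le_right <|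
        mul_le_mul (le_max_of_le_left (norm_le_pi_norm x₁ i))
          (le_max_of_le_right (norm_le_pi_norm y₂ j)) (abs_nonneg _) (by positivity)
    · rw [mul_comm]
      exact le_max_of_le_right <| le_max_of_le_right <|
        mul_le_mul (le_max_of_le_right (norm_le_pi_norm x₂ j))
          (le_max_of_le_left (norm_le_pi_norm y₁ i)) (abs_nonneg _) (by positivity)
    · exact le_max_of_le_right <| le_max_of_le_left <|
        mul_le_mul (norm_le_pi_norm y₁ i) (norm_le_pi_norm y₂ j) (abs_nonneg _) (norm_nonneg _)
  have hgram := gram_le_of_abs_mul_le _ _ hbound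
  simp only [Fintype.sum_sum_type, Sum.elim_inl, Sum.elim_inr, Fintype.card_sum,
    Fintype.card_fin, Nat.cast_add, add_comm (m : ℝ)] at hgram
  calc _ ≤ Real.sqrt (2 * ((n : ℝ) + m) * (((n : ℝ) + m) - 1) * M ^ 2) := Real.sqrt_le_sqrt hgram
    _ = _ := by rw [Real.sqrt_mul' _ (sq_nonneg M), Real.sqrt_sq hM0]
end
end
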